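/- arXiv:1310.1860 — 2 statements merged into one kernel-verified Lean document; each statement's English description precedes it below -/
import Mathlib

section
/- Let G be a finite simple graph and let q ∈ (1,∞). Suppose that either (a) q = 2, l = 3 and G has at least two vertices, or (b) q ≠ 2, l = 2 and G has at least four vertices. Then the following are equivalent: (i) for every generic placement p of G in (ℝ²,‖·‖_q), the rows of the rigidity matrix R_q(G,p) are linearly independent; (ii) G is (2,l)-sparse. -/
open Asymptotics Filter Topology Set

open scoped Classical

noncomputable section

namespace RigidityPaper

variable {V X E : Type}

/-- `p` is a placement of the graph `G`: adjacent vertices are placed at distinct points. -/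
def IsPlacement (G : SimpleGraph V) (p : V → X) : Prop :=
  ∀ ⦃v w⦄, G.Adj v w → p v ≠ p w

section NormedSpace

variable [NormedAddCommGroup X] [NormedSpace ℝ X]

/-- `u` is an infinitesimal flex of the framework `(G,p)` in the normed space `X`. -/
def IsFlex (G : SimpleGraph V) (p u : V → X) : Prop :=
  ∀ ⦃v w⦄, G.Adj v w →
    (fun t : ℝ => ‖(p v + t • u v) - (p w + t • u w)‖ - ‖p v - p w‖)
      =o[𝓝 (0 : ℝ)] (fun t : ℝ => t)

/-- A continuous rigid motion of the normed space `X`. -/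
def IsContRigidMotion (Γ : X → ℝ → X) : Prop :=
  (∀ t ∈ Icc (-1 : ℝ) 1, Isometry (fun x => Γ x t)) ∧
    (∀ x, ContinuousOn (Γ x) (Icc (-1 : ℝ) 1)) ∧ ∀ x, Γ x 0 = x

/-- An infinitesimal rigid motion of the normed space `X`. -/
def IsInfRigidMotion (γ : X → X) : Prop :=
  ∃ Γ, IsContRigidMotion Γ ∧ ∀ x, HasDerivWithinAt (Γ x) (γ x) (Icc (-1 : ℝ) 1) 0

/-- `u` is a trivial (infinitesimal) flex on the vertex set `S`. -/
def IsTrivialOn (p : V → X) (S : Set V) (u : V → X) : Prop :=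
  ∃ γ, IsInfRigidMotion γ ∧ ∀ v ∈ S, u v = γ (p v)

/-- The framework `(G,p)` is infinitesimally rigid. -/
def InfRigid (G : SimpleGraph V) (p : V → X) : Prop :=
  ∀ u, IsFlex G p u → IsTrivialOn p univ u

end NormedSpace

/-- A tower of finite subgraphs of `G`. -/
structure Tower (G : SimpleGraph V) where
  seq : ℕ → G.Subgraph
  mono : ∀ k, seq k ≤ seq (k + 1)
  finite : ∀ k, (seq k).verts.Finite

variable {G : SimpleGraph V}

/-- A tower is vertex-complete if its vertex sets exhaust the vertices of `G`. -/
def VertexComplete (T : Tower G) : Prop := (⋃ k, (T.seq k).verts) = univ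

/-- A tower is edge-complete if its edges exhaust the edges of `G`. -/
def EdgeComplete (T : Tower G) : Prop := ∀ ⦃v w⦄, G.Adj v w → ∃ k, (T.seq k).Adj v w

section NormedSpace

variable [NormedAddCommGroup X] [NormedSpace ℝ X]

/-- The flex cancellation property of a tower of frameworks: every non-trivial
infinitesimal flex of the `k`-th framework fails to extend to some later framework. -/
def FlexCancel (T : Tower G) (p : V → X) : Prop :=
  ∀ k u, IsFlex (T.seq k).spanningCoe p u → ¬ IsTrivialOn p (T.seq k).verts u →
    ∃ m, k < m ∧
      ¬ ∃ u', IsFlex (T.seq m).spanningCoe p u' ∧ ∀ v ∈ (T.seq k).verts, u' v = u v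

/-- A tower of frameworks is relatively infinitesimally rigid: no non-trivial
infinitesimal flex of the `k`-th framework extends to the `(k+1)`-st framework. -/
def RelRigidTower (T : Tower G) (p : V → X) : Prop :=
  ∀ k u, IsFlex (T.seq k).spanningCoe p u →
    (∃ u', IsFlex (T.seq (k + 1)).spanningCoe p u' ∧ ∀ v ∈ (T.seq k).verts, u' v = u v) →
    IsTrivialOn p (T.seq k).verts u

/-- The subframework on the subgraph `H` is infinitesimally rigid. -/
def SubInfRigid (H : G.Subgraph) (p : V → X) : Prop :=
  ∀ u, IsFlex H.spanningCoe p u → IsTrivialOn p H.verts u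

/-- The framework `(G,p)` is sequentially infinitesimally rigid. -/
def SeqInfRigid (G : SimpleGraph V) (p : V → X) : Prop :=
  ∃ T : Tower G, VertexComplete T ∧ ∀ k, SubInfRigid (T.seq k) p

end NormedSpace

/-! ### The `ℓ^q` norms on `ℝ^d` -/

/-- The `ℓ^q` norm on `ℝ^d`. -/
def qnorm (q : ℝ) {d : ℕ} (x : Fin d → ℝ) : ℝ := (∑ i, |x i| ^ q) ^ (1 / q)

/-- `u` is an infinitesimal flex of `(G,p)` in `(ℝ^d, ‖·‖_q)`. -/
def IsQFlex (q : ℝ) {d : ℕ} (G : SimpleGraph V) (p u : V → Fin d → ℝ) : Prop :=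
  ∀ ⦃v w⦄, G.Adj v w →
    (fun t : ℝ => qnorm q ((p v + t • u v) - (p w + t • u w)) - qnorm q (p v - p w))
      =o[𝓝 (0 : ℝ)] (fun t : ℝ => t)

/-- A continuous rigid motion of `(ℝ^d, ‖·‖_q)`. -/
def IsQContRigidMotion (q : ℝ) {d : ℕ} (Γ : (Fin d → ℝ) → ℝ → Fin d → ℝ) : Prop :=
  (∀ t ∈ Icc (-1 : ℝ) 1, ∀ x y, qnorm q (Γ x t - Γ y t) = qnorm q (x - y)) ∧
    (∀ x, ContinuousOn (Γ x) (Icc (-1 : ℝ) 1)) ∧ ∀ x, Γ x 0 = x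

/-- An infinitesimal rigid motion of `(ℝ^d, ‖·‖_q)`. -/
def IsQInfRigidMotion (q : ℝ) {d : ℕ} (γ : (Fin d → ℝ) → Fin d → ℝ) : Prop :=
  ∃ Γ, IsQContRigidMotion q Γ ∧ ∀ x, HasDerivWithinAt (Γ x) (γ x) (Icc (-1 : ℝ) 1) 0

/-- `u` is a trivial flex on the vertex set `S`, for the `ℓ^q` norm. -/
def IsQTrivialOn (q : ℝ) {d : ℕ} (p : V → Fin d → ℝ) (S : Set V) (u : V → Fin d → ℝ) : Prop :=
  ∃ γ, IsQInfRigidMotion q γ ∧ ∀ v ∈ S, u v = γ (p v)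

/-- The framework `(G,p)` is infinitesimally rigid in `(ℝ^d, ‖·‖_q)`. -/
def QInfRigid (q : ℝ) {d : ℕ} (G : SimpleGraph V) (p : V → Fin d → ℝ) : Prop :=
  ∀ u, IsQFlex q G p u → IsQTrivialOn q p univ u

/-- The subframework on the subgraph `H` is infinitesimally rigid in `(ℝ^d, ‖·‖_q)`. -/
def QSubInfRigid (q : ℝ) {d : ℕ} (H : G.Subgraph) (p : V → Fin d → ℝ) : Prop :=
  ∀ u, IsQFlex q H.spanningCoe p u → IsQTrivialOn q p H.verts u

/-! ### The rigidity matrix, regular and generic placements -/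

/-- The entry `sgn(a-b)|a-b|^{q-1}` of the rigidity matrix. -/
def rigidityCoef (q : ℝ) (a b : ℝ) : ℝ := Real.sign (a - b) * |a - b| ^ (q - 1)

/-- The row of the rigidity matrix `R_q(G,p)` corresponding to the (oriented) edge `vw`,
regarded as a vector in `ℝ^{V × d}`. -/
def rigidityRow (q : ℝ) {d : ℕ} (p : V → Fin d → ℝ) (v w : V) : V × Fin d → ℝ :=
  fun x =>
    (if x.1 = v then rigidityCoef q (p v x.2) (p w x.2) else 0) -
      (if x.1 = w then rigidityCoef q (p v x.2) (p w x.2) else 0)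

/-- The rank of the rigidity matrix `R_q(G,p)`, i.e. the dimension of its row space. -/
def rigidityRank (q : ℝ) {d : ℕ} (G : SimpleGraph V) (p : V → Fin d → ℝ) : ℕ :=
  Module.finrank ℝ
    (Submodule.span ℝ {r : V × Fin d → ℝ | ∃ v w, G.Adj v w ∧ r = rigidityRow q p v w})

/-- `(G,p)` is a regular framework in `(ℝ^d, ‖·‖_q)`: the rank of the rigidity matrix is
maximal at `p` over all placements of `G`. -/
def IsRegular (q : ℝ) {d : ℕ} (G : SimpleGraph V) (p : V → Fin d → ℝ) : Prop :=
  IsPlacement G p ∧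
    ∀ x : V → Fin d → ℝ, IsPlacement G x → rigidityRank q G x ≤ rigidityRank q G p

/-- `p` restricts on `W` to a generic placement: it is injective on `W` (a placement of the
complete graph on `W`) and every subframework of the complete graph on `W` is regular. -/
def GenericOn (q : ℝ) {d : ℕ} (p : V → Fin d → ℝ) (W : Set V) : Prop :=
  InjOn p W ∧ ∀ W' : Set V, W' ⊆ W → ∀ H : SimpleGraph W', IsRegular q H (fun x : W' => p x.1)

/-- `p` is a generic placement in `(ℝ^d, ‖·‖_q)`: its restriction to every finite set of
vertices is generic. -/
def IsGeneric (q : ℝ) {d : ℕ} (p : V → Fin d → ℝ) : Prop :=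
  ∀ W : Set V, W.Finite → GenericOn q p W

/-- The graph `G` is rigid in `(ℝ^d, ‖·‖_q)`: every generic placement is infinitesimally
rigid. -/
def Rigid (q : ℝ) (d : ℕ) (G : SimpleGraph V) : Prop :=
  ∀ p : V → Fin d → ℝ, IsGeneric q p → QInfRigid q G p

/-- The graph `G` is sequentially rigid in `(ℝ^d, ‖·‖_q)`: every generic placement is
sequentially infinitesimally rigid. -/
def SeqRigid (q : ℝ) (d : ℕ) (G : SimpleGraph V) : Prop :=
  ∀ p : V → Fin d → ℝ, IsGeneric q p →
    ∃ T : Tower G, VertexComplete T ∧ ∀ k, QSubInfRigid q (T.seq k) p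

/-- The graph `G` is minimally rigid in `(ℝ^d, ‖·‖_q)`. -/
def MinRigid (q : ℝ) (d : ℕ) (G : SimpleGraph V) : Prop :=
  Rigid q d G ∧
    ∀ p : V → Fin d → ℝ, IsGeneric q p → ∀ ⦃v w⦄, G.Adj v w →
      ¬ QInfRigid q (G.deleteEdges {s(v, w)}) p

/-! ### Continuous rigidity in `(ℝ^d, ‖·‖_q)` -/

/-- `α` is a continuous flex of `(G,p)` in `(ℝ^d, ‖·‖_q)`. -/
def IsQContFlex (q : ℝ) {d : ℕ} (G : SimpleGraph V) (p : V → Fin d → ℝ)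
    (α : V → ℝ → Fin d → ℝ) : Prop :=
  (∀ v, ContinuousOn (α v) (Icc (-1 : ℝ) 1)) ∧ (∀ v, α v 0 = p v) ∧
    ∀ ⦃v w⦄, G.Adj v w → ∀ t ∈ Icc (-1 : ℝ) 1, qnorm q (α v t - α w t) = qnorm q (p v - p w)

/-- `(G,p)` is continuously rigid in `(ℝ^d, ‖·‖_q)`: every continuous flex is trivial,
that is, derived from a continuous rigid motion. -/
def QContRigid (q : ℝ) {d : ℕ} (G : SimpleGraph V) (p : V → Fin d → ℝ) : Prop :=
  ∀ α, IsQContFlex q G p α →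
    ∃ Γ, IsQContRigidMotion q Γ ∧ ∀ v, ∀ t ∈ Icc (-1 : ℝ) 1, α v t = Γ (p v) t

/-! ### Sparsity counts -/

/-- A subgraph `H` is `(k,l)`-sparse. -/
def SubSparse (k l : ℕ) (H : G.Subgraph) : Prop :=
  ∀ H' : G.Subgraph, H' ≤ H → 2 ≤ H'.verts.ncard →
    (H'.edgeSet.ncard : ℤ) ≤ (k * H'.verts.ncard : ℤ) - l

/-- A subgraph `H` is `(k,l)`-tight. -/
def SubTight (k l : ℕ) (H : G.Subgraph) : Prop :=
  SubSparse k l H ∧ (H.edgeSet.ncard : ℤ) = (k * H.verts.ncard : ℤ) - l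

/-- A simple graph `G` (on its whole vertex type) is `(k,l)`-sparse. -/
def GraphSparse (k l : ℕ) (G : SimpleGraph V) : Prop :=
  ∀ H : G.Subgraph, 2 ≤ H.verts.ncard →
    (H.edgeSet.ncard : ℤ) ≤ (k * H.verts.ncard : ℤ) - l

/-! ### Graph moves -/

/-- Henneberg vertex extension move of degree 2: adjoin a new vertex `v` together with
edges to two distinct existing vertices. -/
def HennVertexMove (H H' : (⊤ : SimpleGraph V).Subgraph) : Prop :=
  ∃ v v₁ v₂, v ∉ H.verts ∧ v₁ ∈ H.verts ∧ v₂ ∈ H.verts ∧ v₁ ≠ v₂ ∧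
    H'.verts = insert v H.verts ∧
    ∀ a b, H'.Adj a b ↔
      (H.Adj a b ∨ (a = v ∧ (b = v₁ ∨ b = v₂)) ∨ (b = v ∧ (a = v₁ ∨ a = v₂)))

/-- Henneberg edge move of degree 2: remove an edge `v₁v₂` and adjoin a new vertex `v`
together with edges to `v₁`, `v₂` and a third existing vertex `v₃`. -/
def HennEdgeMove (H H' : (⊤ : SimpleGraph V).Subgraph) : Prop :=
  ∃ v v₁ v₂ v₃, v ∉ H.verts ∧ v₁ ∈ H.verts ∧ v₂ ∈ H.verts ∧ v₃ ∈ H.verts ∧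
    H.Adj v₁ v₂ ∧ v₃ ≠ v₁ ∧ v₃ ≠ v₂ ∧
    H'.verts = insert v H.verts ∧
    ∀ a b, H'.Adj a b ↔
      ((H.Adj a b ∧ ¬((a = v₁ ∧ b = v₂) ∨ (a = v₂ ∧ b = v₁))) ∨
        (a = v ∧ (b = v₁ ∨ b = v₂ ∨ b = v₃)) ∨ (b = v ∧ (a = v₁ ∨ a = v₂ ∨ a = v₃)))

/-- Vertex-to-`K₄` move: a vertex `w₀` is chosen, three new vertices `w₁,w₂,w₃` are
adjoined together with all edges among `{w₀,w₁,w₂,w₃}`, and every edge `xw₀` is either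
kept or replaced by an edge `x(f x)` with `f x ∈ {w₀,w₁,w₂,w₃}`. -/
def VertexToK4Move (H H' : (⊤ : SimpleGraph V).Subgraph) : Prop :=
  ∃ w₀ w₁ w₂ w₃, w₀ ∈ H.verts ∧ w₁ ∉ H.verts ∧ w₂ ∉ H.verts ∧ w₃ ∉ H.verts ∧
    w₁ ≠ w₂ ∧ w₁ ≠ w₃ ∧ w₂ ≠ w₃ ∧
    ∃ f : V → V, (∀ x, f x = w₀ ∨ f x = w₁ ∨ f x = w₂ ∨ f x = w₃) ∧
      H'.verts = insert w₁ (insert w₂ (insert w₃ H.verts)) ∧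
      ∀ a b, H'.Adj a b ↔
        ((H.Adj a b ∧ a ≠ w₀ ∧ b ≠ w₀) ∨
          (∃ x, H.Adj x w₀ ∧ ((a = x ∧ b = f x) ∨ (b = x ∧ a = f x))) ∨
          (a ∈ ({w₀, w₁, w₂, w₃} : Set V) ∧ b ∈ ({w₀, w₁, w₂, w₃} : Set V) ∧ a ≠ b))

/-- Vertex-to-4-cycle move: a vertex `v` with neighbours `v₁,v₂` is chosen, a new vertex
`v₀` is adjoined together with the edges `v₀v₁`, `v₀v₂`, and every other edge `vw` is
either kept or replaced by the edge `v₀w`. -/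
def VertexTo4CycleMove (H H' : (⊤ : SimpleGraph V).Subgraph) : Prop :=
  ∃ v v₀ v₁ v₂, v ∈ H.verts ∧ v₀ ∉ H.verts ∧ v₁ ≠ v₂ ∧
    H.Adj v v₁ ∧ H.Adj v v₂ ∧
    ∃ f : V → V, (∀ x, f x = v ∨ f x = v₀) ∧
      H'.verts = insert v₀ H.verts ∧
      ∀ a b, H'.Adj a b ↔
        ((H.Adj a b ∧ a ≠ v ∧ b ≠ v) ∨
          ((a = v ∨ a = v₀) ∧ (b = v₁ ∨ b = v₂)) ∨
          ((b = v ∨ b = v₀) ∧ (a = v₁ ∨ a = v₂)) ∨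
          (∃ w, H.Adj v w ∧ w ≠ v₁ ∧ w ≠ v₂ ∧ ((a = f w ∧ b = w) ∨ (b = f w ∧ a = w))))

/-! ### Multigraphs -/

/-- `(V',E')` is a subgraph of the multigraph with edge-endpoint map `ends`. -/
def MGSubgraph (ends : E → Sym2 V) (V' : Set V) (E' : Set E) : Prop :=
  ∀ e ∈ E', ∀ v ∈ ends e, v ∈ V'

/-- The (multigraph) subgraph `(V',E')` is `(k,l)`-sparse. -/
def MGSparseOn (k l : ℕ) (ends : E → Sym2 V) (V' : Set V) (E' : Set E) : Prop :=
  ∀ (V'' : Set V) (E'' : Set E), V'' ⊆ V' → E'' ⊆ E' → MGSubgraph ends V'' E'' →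
    2 ≤ V''.ncard → (E''.ncard : ℤ) ≤ (k * V''.ncard : ℤ) - l

/-- The (multigraph) subgraph `(V',E')` is `(k,l)`-tight. -/
def MGTightOn (k l : ℕ) (ends : E → Sym2 V) (V' : Set V) (E' : Set E) : Prop :=
  MGSparseOn k l ends V' E' ∧ (E'.ncard : ℤ) = (k * V'.ncard : ℤ) - l

/-- The degree of a vertex in a loopless multigraph. -/
def mgDeg (ends : E → Sym2 V) (v : V) : ℕ := {e | v ∈ ends e}.ncard

/-- Independence of the edge set `E` for edge weights `m`, in terms of pairs of flows. -/
def IndW {V : Type} [Fintype V] (E : Finset (Sym2 V)) (m : V → V → ℝ) : Prop :=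
  ∀ f : V → V → ℝ, (∀ v w, f v w + f w v = 0) → (∀ v w, s(v, w) ∉ E → f v w = 0) →
    (∀ v, ∑ w, f v w = 0) → (∀ v, ∑ w, m v w * f v w = 0) → ∀ v w, f v w = 0

/-- The constraint matrix. -/
def conM {V R : Type} [Fintype V] [CommRing R] (E : Finset (Sym2 V)) (m : V → V → R) :
    Matrix ((V × V) ⊕ ((V × V) ⊕ (V ⊕ V))) (V × V) R :=
  Matrix.of fun i j =>
    Sum.elim (fun a : V × V => (if j = a then 1 else 0) + (if j = (a.2, a.1) then 1 else 0))
      (Sum.elim (fun a : V × V => if j = a then (if s(a.1, a.2) ∈ E then 0 else 1) else 0)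
        (Sum.elim (fun v : V => if j.1 = v then 1 else 0)
          (fun v : V => if j.1 = v then m j.1 j.2 else 0))) i

/-- The Gram determinant of the constraint matrix. -/
def delta {V R : Type} [Fintype V] [CommRing R] (E : Finset (Sym2 V)) (m : V → V → R) : R :=
  ((conM E m).transpose * conM E m).det

theorem delta_map {V R S : Type} [Fintype V] [CommRing R] [CommRing S] (φ : R →+* S)
    (E : Finset (Sym2 V)) (m : V → V → R) :
    φ (delta E m) = delta E (fun v w => φ (m v w)) := by
  unfold delta
  rw [RingHom.map_det, RingHom.mapMatrix_apply, Matrix.map_mul, Matrix.transpose_map]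
  have : (conM E m).map φ = conM E (fun v w => φ (m v w)) := by
    ext i j
    rcases i with a | a | a | a <;> simp [conM, apply_ite φ]
  rw [this]

theorem indW_iff {V : Type} [Fintype V] (E : Finset (Sym2 V)) (m : V → V → ℝ) :
    IndW E m ↔ delta E m ≠ 0 := by
  have key : ∀ g : V × V → ℝ, (conM E m).mulVec g = 0 ↔
      ((∀ v w, g (v, w) + g (w, v) = 0) ∧ (∀ v w, s(v, w) ∉ E → g (v, w) = 0) ∧
      (∀ v, ∑ w, g (v, w) = 0) ∧ (∀ v, ∑ w, m v w * g (v, w) = 0)) := by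
    intro g
    rw [funext_iff]
    simp only [Sum.forall, Prod.forall]
    refine and_congr ?_ (and_congr ?_ (and_congr ?_ ?_))
    · refine forall₂_congr fun v w => ?_
      simp [conM, Matrix.mulVec, dotProduct, add_mul, Finset.sum_add_distrib]
    · refine forall₂_congr fun v w => ?_
      simp [conM, Matrix.mulVec, dotProduct]
    · refine forall_congr' fun v => ?_
      simp [conM, Matrix.mulVec, dotProduct, Fintype.sum_prod_type]
      rw [Finset.sum_comm]; simp
    · refine forall_congr' fun v => ?_
      simp [conM, Matrix.mulVec, dotProduct, Fintype.sum_prod_type]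
  have key2 : ∀ g : V × V → ℝ,
      ((conM E m).transpose * conM E m).mulVec g = 0 ↔ (conM E m).mulVec g = 0 := by
    intro g
    have := Matrix.ker_mulVecLin_transpose_mul_self (conM E m)
    have h := SetLike.ext_iff.1 this g
    rwa [LinearMap.mem_ker, LinearMap.mem_ker, Matrix.mulVecLin_apply, Matrix.mulVecLin_apply] at h
  unfold delta
  rw [Ne, ← Matrix.exists_mulVec_eq_zero_iff]
  constructor
  · rintro h ⟨g, hg, h0⟩
    rw [key2, key] at h0
    apply hg
    ext ⟨v, w⟩
    exact h (fun v w => g (v, w)) h0.1 h0.2.1 h0.2.2.1 h0.2.2.2 v w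
  · intro h f h1 h2 h3 h4 v w
    by_contra hne
    refine h ⟨fun e => f e.1 e.2, ?_, ?_⟩
    · intro h0
      exact hne (congrFun h0 (v, w))
    · rw [key2, key]
      exact ⟨h1, h2, h3, h4⟩

theorem delta_eq_aeval {V : Type} [Fintype V] (E : Finset (Sym2 V)) (m : V → V → ℝ) :
    delta E m = MvPolynomial.aeval (fun e : V × V => m e.1 e.2)
      (delta E (fun v w => (MvPolynomial.X (v, w) : MvPolynomial (V × V) ℝ))) := by
  have := delta_map (MvPolynomial.aeval (fun e : V × V => m e.1 e.2) :
    MvPolynomial (V × V) ℝ →ₐ[ℝ] ℝ).toRingHom E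
      (fun v w => (MvPolynomial.X (v, w) : MvPolynomial (V × V) ℝ))
  simp at this
  exact this.symm

theorem delta_analyticAt {V B : Type} [Fintype V] [NormedAddCommGroup B] [NormedSpace ℝ B]
    (E : Finset (Sym2 V)) (m : B → V → V → ℝ) (b : B)
    (hm : ∀ v w, AnalyticAt ℝ (fun x => m x v w) b) :
    AnalyticAt ℝ (fun x => delta E (m x)) b := by
  simp_rw [delta_eq_aeval]
  exact AnalyticAt.aeval_mvPolynomial (f := fun x (e : V × V) => m x e.1 e.2)
    (fun i => hm i.1 i.2) _

theorem delta_continuous {V : Type} [Fintype V] (E : Finset (Sym2 V)) :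
    Continuous (fun m : V → V → ℝ => delta E m) := by
  rw [continuous_iff_continuousAt]
  intro m
  refine (delta_analyticAt E (fun m => m) m fun v w => ?_).continuousAt
  exact ((ContinuousLinearMap.proj (R := ℝ) (φ := fun _ : V => ℝ) w).comp
    (ContinuousLinearMap.proj (R := ℝ) (φ := fun _ : V => V → ℝ) v)).analyticAt m

theorem indW_of_tendsto {V ι : Type} [Fintype V] {E : Finset (Sym2 V)} {F : Filter ι}
    {m : ι → V → V → ℝ} {m0 : V → V → ℝ} (h : IndW E m0)
    (hm : ∀ v w, Tendsto (fun i => m i v w) F (𝓝 (m0 v w))) : ∀ᶠ i in F, IndW E (m i) := by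
  simp_rw [indW_iff] at *
  have : Tendsto m F (𝓝 m0) := tendsto_pi_nhds.2 fun v => tendsto_pi_nhds.2 fun w => hm v w
  exact ((delta_continuous E).continuousAt.tendsto.comp this).eventually_ne h

theorem indW_congr {V : Type} [Fintype V] {E : Finset (Sym2 V)}
    {m m' : V → V → ℝ} (hm : ∀ v w, s(v, w) ∈ E → v ≠ w → m v w = m' v w) (h : IndW E m) :
    IndW E m' := by
  intro f h1 h2 h3 h4
  refine h f h1 h2 h3 fun v => ?_
  rw [← h4 v]
  refine Finset.sum_congr rfl fun w _ => ?_
  by_cases hvw : v = w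
  · subst hvw
    have : f v v = 0 := by linarith [h1 v v]
    simp [this]
  · by_cases hE : s(v, w) ∈ E
    · rw [hm v w hE hvw]
    · simp [h2 v w hE]

theorem delta_isBigO {V : Type} [Fintype V] (E : Finset (Sym2 V)) {m m' : ℝ → V → V → ℝ}
    {m0 : V → V → ℝ} {g : ℝ → ℝ} {F : Filter ℝ}
    (h : ∀ v w, Tendsto (fun i => m i v w) F (𝓝 (m0 v w)))
    (h' : ∀ v w, Tendsto (fun i => m' i v w) F (𝓝 (m0 v w)))
    (hO : ∀ v w, (fun ε => m ε v w - m' ε v w) =O[F] g) :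
    (fun ε => delta E (m ε) - delta E (m' ε)) =O[F] g := by
  have han : AnalyticAt ℝ (fun m : V → V → ℝ => delta E m) m0 :=
    delta_analyticAt E (fun m => m) m0 fun v w => 
     ((ContinuousLinearMap.proj (R := ℝ) (φ := fun _ : V => ℝ) w).comp
    (ContinuousLinearMap.proj (R := ℝ) (φ := fun _ : V => V → ℝ) v)).analyticAt m0
  have h1 : Tendsto m F (𝓝 m0) := tendsto_pi_nhds.2 fun v => tendsto_pi_nhds.2 fun w => h v w
  have h2 : Tendsto m' F (𝓝 m0) := tendsto_pi_nhds.2 fun v => tendsto_pi_nhds.2 fun w => h' v w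
  have h3 := han.hasStrictFDerivAt.isBigO_sub
  have h4 := h3.comp_tendsto (h1.prodMk_nhds h2)
  refine h4.trans ?_
  simp only [Function.comp_def]
  refine isBigO_pi.2 fun v => isBigO_pi.2 fun w => hO v w

theorem poly_coeff_zero (N : ℕ) : ∀ (w : Polynomial ℝ)
    (_ : (fun ε => w.eval ε) =O[𝓝[≠] (0:ℝ)] fun ε => ε ^ N), ∀ j < N, w.coeff j = 0 := by
  induction N with
  | zero => intro w _ j hj; omega
  | succ N ih =>
    intro w h j hj
    have h0 : w.coeff 0 = 0 := by
      rw [Polynomial.coeff_zero_eq_eval_zero]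
      have t1 : Tendsto (fun ε => w.eval ε) (𝓝[≠] (0:ℝ)) (𝓝 (w.eval 0)) :=
        (w.continuous.tendsto 0).mono_left nhdsWithin_le_nhds
      have t2 : Tendsto (fun ε : ℝ => ε ^ (N + 1)) (𝓝[≠] (0:ℝ)) (𝓝 0) := by
        have : Tendsto (fun ε : ℝ => ε ^ (N + 1)) (𝓝 (0:ℝ)) (𝓝 (0 ^ (N+1))) :=
          (continuous_pow (N+1)).tendsto 0
        rw [zero_pow (by omega)] at this
        exact this.mono_left nhdsWithin_le_nhds
      exact tendsto_nhds_unique t1 (h.trans_tendsto t2)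
    cases j with
    | zero => exact h0
    | succ j =>
      rw [← Polynomial.coeff_divX]
      refine ih w.divX ?_ j (by omega)
      have hw : ∀ ε, w.eval ε = ε * w.divX.eval ε := by
        intro ε
        conv_lhs => rw [← Polynomial.X_mul_divX_add w]
        simp [h0]
      have h2 := (isBigO_refl (fun ε : ℝ => ε⁻¹) (𝓝[≠] (0:ℝ))).mul h
      refine (IsBigO.congr' h2 ?_ ?_)
      · filter_upwards [self_mem_nhdsWithin] with ε hε
        have : ε ≠ 0 := hε
        rw [hw]; field_simp
      · filter_upwards [self_mem_nhdsWithin] with ε hε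
        have : ε ≠ 0 := hε
        field_simp
        ring

theorem poly_isBigO (N : ℕ) (w : Polynomial ℝ) (h : ∀ j < N, w.coeff j = 0) :
    (fun ε => w.eval ε) =O[𝓝 (0:ℝ)] fun ε => ε ^ N := by
  obtain ⟨g, rfl⟩ := Polynomial.X_pow_dvd_iff.2 h
  simp only [Polynomial.eval_mul, Polynomial.eval_pow, Polynomial.eval_X]
  have : (fun ε => g.eval ε) =O[𝓝 (0:ℝ)] fun _ => (1:ℝ) :=
    (g.continuous.tendsto 0).isBigO_one ℝ
  simpa using (isBigO_refl (fun ε : ℝ => ε ^ N) (𝓝 0)).mul this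

theorem analyticAt_rpow' {B : Type} [NormedAddCommGroup B] [NormedSpace ℝ B] (α : ℝ) {f : B → ℝ}
    {b : B} (hf : AnalyticAt ℝ f b) (h : f b ≠ 0) : AnalyticAt ℝ (fun x => (f x) ^ α) b := by
  have h1 : AnalyticAt ℝ (fun y : ℝ => y ^ α) (f b) :=
    (Real.contDiffAt_rpow_const_of_ne (n := ⊤) h).analyticAt
  exact h1.comp hf

theorem rpow_taylor (α : ℝ) : ∃ b : ℕ → ℝ, ∀ N,
    (fun x : ℝ => (1 + x) ^ α - ∑ k ∈ Finset.range N, b k * x ^ k) =O[𝓝 0] fun x => x ^ N := by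
  have han : AnalyticAt ℝ (fun x : ℝ => (1 + x) ^ α) 0 := by
    refine analyticAt_rpow' α (by fun_prop) (by norm_num)
  obtain ⟨p, hp⟩ := han
  refine ⟨fun k => p.coeff k, fun N => ?_⟩
  have := hp.isBigO_sub_partialSum_pow N
  simp only [zero_add, FormalMultilinearSeries.partialSum] at this
  refine (this.congr_left ?_).trans ?_
  · intro x
    congr 1
    refine Finset.sum_congr rfl fun k _ => ?_
    rw [FormalMultilinearSeries.apply_eq_pow_smul_coeff]; simp [mul_comm]
  · refine IsBigO.of_bound 1 ?_
    filter_upwards with x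
    simp

/-- `x` and `y` induce the same strict order on `V`. -/
def CoM {V : Type} (x y : V → ℝ) : Prop := ∀ v w, v ≠ w → 0 < (x v - x w) * (y v - y w)

/-- Powers of slopes. -/
def slo {V : Type} (α : ℝ) (x y : V → ℝ) (v w : V) : ℝ := ((y v - y w) / (x v - x w)) ^ α

/-- Some comonotone placement makes `E` independent. -/
def Good {V : Type} [Fintype V] (α : ℝ) (E : Finset (Sym2 V)) : Prop :=
  ∃ x y : V → ℝ, CoM x y ∧ IndW E (slo α x y)

/-- The polynomial slopes, with denominators cleared. -/
def Tpoly {V : Type} [Fintype V] (v w : V) : MvPolynomial (V × Fin 2) ℝ :=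
  (MvPolynomial.X (v, 1) - MvPolynomial.X (w, 1)) *
    ∏ e ∈ (Finset.univ : Finset (V × V)).filter (fun e => e.1 ≠ e.2 ∧ e ≠ (v, w)),
      (MvPolynomial.X (e.1, 0) - MvPolynomial.X (e.2, 0))

/-- The common denominator. -/
def Dpoly (V : Type) [Fintype V] : MvPolynomial (V × Fin 2) ℝ :=
  ∏ e ∈ (Finset.univ : Finset (V × V)).filter (fun e => e.1 ≠ e.2),
      (MvPolynomial.X (e.1, 0) - MvPolynomial.X (e.2, 0))

theorem Dpoly_eval_ne {V : Type} [Fintype V] (ξ : V × Fin 2 → ℝ) :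
    MvPolynomial.eval ξ (Dpoly V) ≠ 0 ↔ ∀ v w, v ≠ w → ξ (v, 0) ≠ ξ (w, 0) := by
  simp [Dpoly, map_prod, Finset.prod_ne_zero_iff, sub_ne_zero]

theorem Tpoly_eval {V : Type} [Fintype V] (ξ : V × Fin 2 → ℝ)
    (h : ∀ v w, v ≠ w → ξ (v, 0) ≠ ξ (w, 0)) (v w : V) :
    MvPolynomial.eval ξ (Tpoly v w) =
      MvPolynomial.eval ξ (Dpoly V) * ((ξ (v, 1) - ξ (w, 1)) / (ξ (v, 0) - ξ (w, 0))) := by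
  by_cases hvw : v = w
  · subst hvw; simp [Tpoly]
  have hne := sub_ne_zero.2 (h v w hvw)
  have : (Finset.univ : Finset (V × V)).filter (fun e => e.1 ≠ e.2) =
      insert (v, w) ((Finset.univ : Finset (V × V)).filter
        (fun e => e.1 ≠ e.2 ∧ e ≠ (v, w))) := by
    ext e
    simp only [Finset.mem_filter, Finset.mem_insert, Finset.mem_univ, true_and]
    constructor
    · intro h; by_cases he : e = (v, w)
      · exact Or.inl he
      · exact Or.inr ⟨h, he⟩
    · rintro (rfl | h)
      · exact hvw
      · exact h.1
  rw [Dpoly, this, Finset.prod_insert (by simp), Tpoly]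
  simp only [map_mul, map_sub, MvPolynomial.eval_X]
  field_simp

/-- Truncated determinant polynomial. -/
def Wpoly {V : Type} [Fintype V] (b : ℕ → ℝ) (E : Finset (Sym2 V)) (N : ℕ) :
    Polynomial (MvPolynomial (V × Fin 2) ℝ) :=
  delta E (fun v w => ∑ k ∈ Finset.range N,
    Polynomial.C (MvPolynomial.C (b k) * Tpoly v w ^ k) * Polynomial.X ^ k)

theorem Wpoly_eval {V : Type} [Fintype V] (b : ℕ → ℝ) (E : Finset (Sym2 V)) (N : ℕ)
    (ξ : V × Fin 2 → ℝ) (ε : ℝ) :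
    ((Wpoly b E N).map (MvPolynomial.eval ξ)).eval ε =
      delta E (fun v w => ∑ k ∈ Finset.range N,
        b k * (ε * MvPolynomial.eval ξ (Tpoly v w)) ^ k) := by
  have := delta_map ((Polynomial.evalRingHom ε).comp (Polynomial.mapRingHom (MvPolynomial.eval ξ)))
    E (fun v w => ∑ k ∈ Finset.range N,
    Polynomial.C (MvPolynomial.C (b k) * Tpoly v w ^ k) * Polynomial.X ^ k)
  simp only [RingHom.comp_apply, Polynomial.coe_evalRingHom, Polynomial.coe_mapRingHom] at this
  rw [Wpoly, this]
  congr 1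
  ext v w
  simp only [Polynomial.map_sum, Polynomial.eval_finset_sum]
  refine Finset.sum_congr rfl fun k _ => ?_
  simp [mul_pow]
  ring

theorem F_analyticAt {V : Type} [Fintype V] (α : ℝ) (E : Finset (Sym2 V)) (t : V → V → ℝ) (ε : ℝ)
    (h : ∀ v w, 0 < 1 + ε * t v w) :
    AnalyticAt ℝ (fun ε : ℝ => delta E (fun v w => (1 + ε * t v w) ^ α)) ε := by
  refine delta_analyticAt E (fun ε v w => (1 + ε * t v w) ^ α) ε fun v w => ?_
  exact analyticAt_rpow' α (by fun_prop) (h v w).ne'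

theorem F_approx {V : Type} [Fintype V] {α : ℝ} {b : ℕ → ℝ} (hb : ∀ N,
    (fun x : ℝ => (1 + x) ^ α - ∑ k ∈ Finset.range N, b k * x ^ k) =O[𝓝 0] fun x => x ^ N)
    (E : Finset (Sym2 V)) (t : V → V → ℝ) (N : ℕ) (hN : 0 < N) :
    (fun ε : ℝ => delta E (fun v w => (1 + ε * t v w) ^ α) -
      delta E (fun v w => ∑ k ∈ Finset.range N, b k * (ε * t v w) ^ k)) =O[𝓝 0] fun ε => ε ^ N := by
  have ht : ∀ v w, Tendsto (fun ε : ℝ => ε * t v w) (𝓝 0) (𝓝 0) := by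
    intro v w
    have : Continuous (fun ε : ℝ => ε * t v w) := by fun_prop
    simpa using this.tendsto 0
  have hO : ∀ v w, (fun ε : ℝ => (1 + ε * t v w) ^ α -
      ∑ k ∈ Finset.range N, b k * (ε * t v w) ^ k) =O[𝓝 0] fun ε => ε ^ N := by
    intro v w
    refine ((hb N).comp_tendsto (ht v w)).trans ?_
    simp only [Function.comp_def, mul_pow]
    have := (isBigO_refl (fun ε : ℝ => ε ^ N) (𝓝 0)).const_mul_left (t v w ^ N)
    refine this.congr_left fun ε => by ring
  have h1 : ∀ v w, Tendsto (fun ε : ℝ => (1 + ε * t v w) ^ α) (𝓝 0) (𝓝 1) := by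
    intro v w
    have : ContinuousAt (fun ε : ℝ => (1 + ε * t v w) ^ α) 0 :=
      (analyticAt_rpow' α (by fun_prop) (by norm_num)).continuousAt
    have h := this.tendsto
    simpa using h
  refine delta_isBigO E (m0 := fun _ _ => 1) h1 (fun v w => ?_) hO
  have h2 : Tendsto (fun ε : ℝ => ε ^ N) (𝓝 0) (𝓝 0) := by
    have := (continuous_pow (M := ℝ) N).tendsto 0
    rwa [zero_pow hN.ne'] at this
  have h3 := (h1 v w).sub ((hO v w).trans_tendsto h2)
  simpa using h3

theorem common {V : Type} [Fintype V] (α : ℝ) (P : Finset (Sym2 V) → Prop)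
    (hP : ∀ E, P E → Good α E) :
    ∃ x y : V → ℝ, CoM x y ∧ ∀ E, P E → IndW E (slo α x y) := by
  obtain ⟨b, hb⟩ := rpow_taylor α
  have c1 : ∀ E, P E → ∃ N j, j < N ∧ (Wpoly b E N).coeff j ≠ 0 := by
    intro E hE
    obtain ⟨x, y, hxy, hind⟩ := hP E hE
    let ξ : V × Fin 2 → ℝ := fun e => if e.2 = 0 then x e.1 else y e.1 - x e.1
    have hx : ∀ v w, v ≠ w → x v - x w ≠ 0 := by
      intro v w hvw h0
      have := hxy v w hvw
      rw [h0] at this; simp at this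
    have hξ : ∀ v w, v ≠ w → ξ (v, 0) ≠ ξ (w, 0) := by
      intro v w hvw
      have := hx v w hvw
      simpa [ξ, sub_ne_zero] using this
    have hD := (Dpoly_eval_ne ξ).2 hξ
    set D := MvPolynomial.eval ξ (Dpoly V) with hDdef
    set t : V → V → ℝ := fun v w => MvPolynomial.eval ξ (Tpoly v w) with ht
    have htv : ∀ v w, v ≠ w → D⁻¹ * t v w = (y v - y w) / (x v - x w) - 1 := by
      intro v w hvw
      have := hx v w hvw
      simp only [ht, Tpoly_eval ξ hξ, ← hDdef]
      simp [ξ]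
      field_simp
      ring
    have htd : ∀ v, t v v = 0 := by intro v; simp [ht, Tpoly]
    let F : ℝ → ℝ := fun ε => delta E (fun v w => (1 + ε * t v w) ^ α)
    let U : Set ℝ := {ε | ∀ v w, 0 < 1 + ε * t v w}
    have hUc : Convex ℝ U := by
      have : U = ⋂ v, ⋂ w, {ε : ℝ | 0 < 1 + ε * t v w} := by ext; simp [U]
      rw [this]
      refine convex_iInter fun v => convex_iInter fun w => ?_
      intro a ha c hc p r hp hr hpr
      simp only [Set.mem_setOf_eq, smul_eq_mul] at *
      have : 1 + (p * a + r * c) * t v w = p * (1 + a * t v w) + r * (1 + c * t v w) := by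
        linear_combination (-1 : ℝ) * hpr
      rw [this]
      rcases hp.eq_or_lt with h | h
      · have hr1 : r = 1 := by linarith
        rw [← h, hr1]; linarith
      · have := mul_pos h ha
        have := mul_nonneg hr hc.le
        linarith
    have hFan : AnalyticOnNhd ℝ F U := fun ε hε => F_analyticAt α E t ε hε
    have h0U : (0:ℝ) ∈ U := by intro v w; simp
    have h1U : D⁻¹ ∈ U := by
      intro v w
      by_cases hvw : v = w
      · subst hvw; simp [htd]
      · rw [htv v w hvw]
        have h1 := hxy v w hvw
        have h2 := hx v w hvw
        have : (y v - y w) / (x v - x w) = (x v - x w) * (y v - y w) / (x v - x w) ^ 2 := by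
          field_simp
        have : 0 < (y v - y w) / (x v - x w) := by rw [this]; positivity
        linarith
    have hF1 : F D⁻¹ ≠ 0 := by
      rw [← indW_iff]
      refine indW_congr (fun v w _ hvw => ?_) hind
      rw [htv v w hvw, slo]; congr 1; ring
    have hnz : ¬ (∀ᶠ ε in 𝓝 (0:ℝ), F ε = 0) := by
      intro h
      exact hF1 (hFan.eqOn_zero_of_preconnected_of_eventuallyEq_zero hUc.isPreconnected h0U h h1U)
    obtain ⟨k, g, hg, hg0, hFg⟩ :=
      (hFan 0 h0U).exists_eventuallyEq_pow_smul_nonzero_iff.2 hnz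
    refine ⟨k + 1, ?_⟩
    by_contra hcon
    push Not at hcon
    have hO := poly_isBigO (k + 1) ((Wpoly b E (k + 1)).map (MvPolynomial.eval ξ))
      (fun j hj => by rw [Polynomial.coeff_map, hcon j hj, map_zero])
    simp only [Wpoly_eval] at hO
    have hO2 := (F_approx hb E t (k + 1) (by omega)).add hO
    simp only [ht, sub_add_cancel] at hO2
    have hO3 : (fun ε : ℝ => ε ^ k * g ε) =O[𝓝 0] fun ε => ε ^ (k + 1) := by
      refine hO2.congr' ?_ (EventuallyEq.refl _ _)
      filter_upwards [hFg] with ε hε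
      simpa using hε
    have hO4 : g =O[𝓝[≠] 0] fun ε : ℝ => ε := by
      have := (isBigO_refl (fun ε : ℝ => (ε ^ k)⁻¹) (𝓝[≠] (0:ℝ))).mul
        (hO3.mono nhdsWithin_le_nhds)
      refine this.congr' ?_ ?_
      · filter_upwards [self_mem_nhdsWithin] with ε hε
        have : ε ≠ 0 := hε
        field_simp
      · filter_upwards [self_mem_nhdsWithin] with ε hε
        have : ε ≠ 0 := hε
        field_simp
        ring
    have hl : Tendsto (fun ε : ℝ => ε) (𝓝[≠] (0:ℝ)) (𝓝 0) := nhdsWithin_le_nhds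
    exact hg0 (tendsto_nhds_unique (hg.continuousAt.tendsto.mono_left nhdsWithin_le_nhds)
      (hO4.trans_tendsto hl))
  choose! N j hj hc using c1
  let Q : MvPolynomial (V × Fin 2) ℝ := Dpoly V *
    ∏ E ∈ (Finset.univ : Finset (Finset (Sym2 V))).filter P, (Wpoly b E (N E)).coeff (j E)
  have hQ : Q ≠ 0 := by
    refine mul_ne_zero ?_ (Finset.prod_ne_zero_iff.2 fun E hE => hc E (Finset.mem_filter.1 hE).2)
    intro h0
    obtain ⟨e⟩ := Fintype.truncEquivFin V |>.nonempty
    refine (Dpoly_eval_ne (fun a : V × Fin 2 => ((e a.1 : ℕ) : ℝ))).2 ?_ (by rw [h0]; simp)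
    intro v w hvw h
    simp only [Nat.cast_inj] at h
    exact hvw (e.injective (Fin.ext h))
  obtain ⟨ξ, hξ⟩ : ∃ ξ, MvPolynomial.eval ξ Q ≠ 0 := by
    by_contra hcon
    push Not at hcon
    exact hQ (MvPolynomial.funext fun ξ => by simp [hcon ξ])
  simp only [Q, map_mul, map_prod, mul_ne_zero_iff, Finset.prod_ne_zero_iff, Finset.mem_filter,
    Finset.mem_univ, true_and] at hξ
  obtain ⟨hD, hW⟩ := hξ
  have hinj := (Dpoly_eval_ne ξ).1 hD
  set D := MvPolynomial.eval ξ (Dpoly V) with hDdef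
  set t : V → V → ℝ := fun v w => MvPolynomial.eval ξ (Tpoly v w) with ht
  have e1 : ∀ᶠ ε in 𝓝[≠] (0:ℝ), ∀ E, P E → delta E (fun v w => (1 + ε * t v w) ^ α) ≠ 0 := by
    rw [eventually_all]
    intro E
    by_cases hE : P E
    swap
    · exact Eventually.of_forall fun ε h => absurd h hE
    rcases (F_analyticAt α E t 0 (by simp)).eventually_eq_zero_or_eventually_ne_zero with h | h
    · exfalso
      have hO := F_approx hb E t (N E) (by have := hj E hE; omega)
      have hO2 : (fun ε => ((Wpoly b E (N E)).map (MvPolynomial.eval ξ)).eval ε) =O[𝓝 0]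
          fun ε => ε ^ (N E) := by
        simp only [Wpoly_eval]
        refine (hO.neg_left).congr' ?_ (EventuallyEq.refl _ _)
        filter_upwards [h] with ε hε
        rw [hε]; simp [ht]
      have := poly_coeff_zero (N E) _ (hO2.mono nhdsWithin_le_nhds) (j E) (hj E hE)
      rw [Polynomial.coeff_map] at this
      exact hW E hE this
    · filter_upwards [h] with ε hε _ using hε
  have e2 : ∀ᶠ ε in 𝓝[≠] (0:ℝ), ∀ v w, 0 < 1 + ε * t v w := by
    refine (Filter.Eventually.filter_mono nhdsWithin_le_nhds ?_)
    rw [eventually_all]; intro v; rw [eventually_all]; intro w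
    have : Continuous (fun ε : ℝ => 1 + ε * t v w) := by fun_prop
    refine this.continuousAt.eventually (lt_mem_nhds ?_)
    simp
  obtain ⟨ε, h1, h2⟩ := (e1.and e2).exists
  have hs : ∀ v w, v ≠ w → ((ξ (v, 0) + ε * D * ξ (v, 1)) - (ξ (w, 0) + ε * D * ξ (w, 1))) /
      (ξ (v, 0) - ξ (w, 0)) = 1 + ε * t v w := by
    intro v w hvw
    have := sub_ne_zero.2 (hinj v w hvw)
    simp only [ht, Tpoly_eval ξ hinj, ← hDdef]
    field_simp
    ring
  refine ⟨fun v => ξ (v, 0), fun v => ξ (v, 0) + ε * D * ξ (v, 1), ?_, ?_⟩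
  · intro v w hvw
    have h3 := sub_ne_zero.2 (hinj v w hvw)
    have h4 := hs v w hvw
    rw [div_eq_iff h3] at h4
    simp only
    rw [h4]
    have := h2 v w
    have : (ξ (v, 0) - ξ (w, 0)) * ((1 + ε * t v w) * (ξ (v, 0) - ξ (w, 0))) =
      (1 + ε * t v w) * (ξ (v, 0) - ξ (w, 0)) ^ 2 := by ring
    rw [this]; positivity
  · intro E hE
    refine indW_congr (fun v w _ hvw => ?_) ((indW_iff _ _).2 (h1 E hE))
    rw [slo, hs v w hvw]

theorem slo_symm {V : Type} (α : ℝ) (x y : V → ℝ) (v w : V) : slo α x y v w = slo α x y w v := by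
  unfold slo
  rw [← neg_sub (y w), ← neg_sub (x w), neg_div_neg_eq]

theorem CoM.ne {V : Type} {x y : V → ℝ} (h : CoM x y) {v w : V} (hvw : v ≠ w) : x v ≠ x w := by
  intro h1
  have := h v w hvw
  rw [h1] at this
  simp at this

theorem CoM.slope_pos {V : Type} {x y : V → ℝ} (h : CoM x y) {v w : V} (hvw : v ≠ w) :
    0 < (y v - y w) / (x v - x w) := by
  have h1 := h v w hvw
  have h2 : x v - x w ≠ 0 := sub_ne_zero.2 (h.ne hvw)
  have : (y v - y w) / (x v - x w) = ((x v - x w) * (y v - y w)) / (x v - x w) ^ 2 := by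
    field_simp
  rw [this]
  positivity

theorem CoM.symm_left {V : Type} {x y : V → ℝ}
    (h : ∀ v w, v ≠ w → x v < x w → y v < y w) (hx : Function.Injective x) : CoM x y := by
  intro v w hvw
  rcases lt_or_gt_of_ne (hx.ne hvw) with h1 | h1
  · exact mul_pos_of_neg_of_neg (sub_neg.2 h1) (sub_neg.2 (h v w hvw h1))
  · exact mul_pos (sub_pos.2 h1) (sub_pos.2 (h w v hvw.symm h1))

theorem com_update {V : Type} {x y : V → ℝ} (h : CoM x y) (v : V) {X Y : ℝ}
    (hX : ∀ w, x w < X) (hY : ∀ w, y w < Y) :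
    CoM (Function.update x v X) (Function.update y v Y) := by
  intro a b hab
  by_cases ha : a = v
  · subst ha
    simp only [Function.update_self, Function.update_of_ne hab.symm]
    exact mul_pos (sub_pos.2 (hX b)) (sub_pos.2 (hY b))
  · by_cases hb : b = v
    · subst hb
      simp only [Function.update_self, Function.update_of_ne ha]
      exact mul_pos_of_neg_of_neg (sub_neg.2 (hX a)) (sub_neg.2 (hY a))
    · simp only [Function.update_of_ne ha, Function.update_of_ne hb]
      exact h a b hab

theorem indW_mono {V : Type} [Fintype V] {E E' : Finset (Sym2 V)} {m : V → V → ℝ} (hE : E ⊆ E')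
    (h : IndW E' m) : IndW E m := fun f h1 h2 h3 h4 =>
  h f h1 (fun v w hvw => h2 v w (fun h' => hvw (hE h'))) h3 h4

theorem good_empty {V : Type} [Fintype V] (α : ℝ) : Good α (∅ : Finset (Sym2 V)) := by
  refine ⟨fun v => ((Fintype.equivFin V v : ℕ) : ℝ), fun v => ((Fintype.equivFin V v : ℕ) : ℝ),
    ?_, fun f _ h _ _ v w => h v w (by simp)⟩
  refine CoM.symm_left (fun v w _ h => h) ?_
  intro v w h
  simpa [Fin.val_inj] using h

theorem exists_gt {V : Type} [Fintype V] (x : V → ℝ) : ∃ X, ∀ w, x w < X := by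
  obtain ⟨M, hM⟩ := (Set.finite_range x).bddAbove
  exact ⟨M + 1, fun w => by linarith [hM ⟨w, rfl⟩]⟩

theorem sum_two {V : Type} [Fintype V] (g : V → ℝ) {a b : V} (hab : a ≠ b)
    (h : ∀ w, w ≠ a → w ≠ b → g w = 0) : ∑ w, g w = g a + g b :=
  Fintype.sum_eq_add a b hab fun w hw => h w hw.1 hw.2

theorem sum_three {V : Type} [Fintype V] (g : V → ℝ) {a b c : V} (hab : a ≠ b) (hac : a ≠ c)
    (hbc : b ≠ c) (h : ∀ w, w ≠ a → w ≠ b → w ≠ c → g w = 0) :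
    ∑ w, g w = g a + g b + g c := by
  rw [← Finset.sum_subset (Finset.subset_univ {a, b, c})]
  · rw [Finset.sum_insert (by simp [hab, hac]), Finset.sum_insert (by simp [hbc]),
      Finset.sum_singleton]
    ring
  · intro w _ hw
    simp only [Finset.mem_insert, Finset.mem_singleton, not_or] at hw
    exact h w hw.1 hw.2.1 hw.2.2

theorem good_ext0 {V : Type} [Fintype V] {α : ℝ} (hα : 0 < α) {E : Finset (Sym2 V)} (v a b : V)
    (hav : a ≠ v) (hbv : b ≠ v) (hv : ∀ w, s(v, w) ∈ E → w = a ∨ w = b)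
    (hg : Good α (E.filter (v ∉ ·))) : Good α E := by
  obtain ⟨x, y, hxy, hI⟩ := hg
  obtain ⟨X, hX⟩ := exists_gt x
  obtain ⟨Y0, hY0⟩ := exists_gt y
  obtain ⟨Y, hY, hab⟩ : ∃ Y, (∀ w, y w < Y) ∧
      (a ≠ b → (Y - y a) / (X - x a) ≠ (Y - y b) / (X - x b)) := by
    by_contra hcon
    push Not at hcon
    obtain ⟨hne, h1⟩ := hcon Y0 hY0
    obtain ⟨_, h2⟩ := hcon (Y0 + 1) (fun w => by linarith [hY0 w])
    have e1 := sub_pos.2 (hX a)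
    have e2 := sub_pos.2 (hX b)
    rw [div_eq_div_iff e1.ne' e2.ne'] at h1 h2
    exact hxy.ne hne (by linarith)
  refine ⟨Function.update x v X, Function.update y v Y, com_update hxy v hX hY, ?_⟩
  have hI' : IndW (E.filter (v ∉ ·)) (slo α (Function.update x v X) (Function.update y v Y)) := by
    refine indW_congr ?_ hI
    intro u w huw _
    simp only [Finset.mem_filter, Sym2.mem_iff, not_or] at huw
    unfold slo
    rw [Function.update_of_ne (Ne.symm huw.2.1), Function.update_of_ne (Ne.symm huw.2.2),
      Function.update_of_ne (Ne.symm huw.2.1), Function.update_of_ne (Ne.symm huw.2.2)]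
  intro f h1 h2 h3 h4
  have hz : ∀ w, f v w = 0 := by
    have hz0 : ∀ w, w ≠ a → w ≠ b → f v w = 0 := fun w ha hb => h2 v w fun h => by
      rcases hv w h with h | h <;> contradiction
    by_cases hne : a = b
    · subst hne
      have h := h3 v
      rw [Fintype.sum_eq_single a (fun w hw => hz0 w hw hw)] at h
      intro w
      by_cases hw : w = a
      · rw [hw, h]
      · exact hz0 w hw hw
    · have e3 := h3 v
      have e4 := h4 v
      rw [sum_two _ hne hz0] at e3
      rw [sum_two _ hne (fun w ha hb => by rw [hz0 w ha hb, mul_zero])] at e4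
      have hm : slo α (Function.update x v X) (Function.update y v Y) v a ≠
          slo α (Function.update x v X) (Function.update y v Y) v b := by
        unfold slo
        simp only [Function.update_self, Function.update_of_ne hav, Function.update_of_ne hbv]
        intro h
        refine hab hne ((Real.rpow_left_inj ?_ ?_ hα.ne').1 h)
        · exact (div_pos (sub_pos.2 (hY a)) (sub_pos.2 (hX a))).le
        · exact (div_pos (sub_pos.2 (hY b)) (sub_pos.2 (hX b))).le
      have hfa : f v a = 0 := by
        have : (slo α (Function.update x v X) (Function.update y v Y) v a -
          slo α (Function.update x v X) (Function.update y v Y) v b) * f v a = 0 := by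
          linear_combination e4 - slo α (Function.update x v X) (Function.update y v Y) v b * e3
        rcases mul_eq_zero.1 this with h | h
        · exact absurd (sub_eq_zero.1 h) hm
        · exact h
      intro w
      by_cases hwa : w = a
      · rw [hwa, hfa]
      by_cases hwb : w = b
      · rw [hwb]; linarith
      exact hz0 w hwa hwb
  refine hI' f h1 ?_ h3 h4
  intro u w huw
  by_cases hE : s(u, w) ∈ E
  · have : v ∈ s(u, w) := by
      by_contra h
      exact huw (Finset.mem_filter.2 ⟨hE, h⟩)
    rcases Sym2.mem_iff.1 this with h | h
    · rw [← h]; exact hz w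
    · have := h1 u w
      rw [← h] at this ⊢
      linarith [hz u]
  · exact h2 u w hE

theorem noncol {V : Type} [Fintype V] {α : ℝ} (hα : 0 < α) {E : Finset (Sym2 V)} (a b c : V)
    (hab : a ≠ b) (hac : a ≠ c) (hbc : b ≠ c) (hg : Good α E) :
    ∃ x y, CoM x y ∧ IndW E (slo α x y) ∧
      (y c - y a) ≠ (y b - y a) / (x b - x a) * (x c - x a) := by
  obtain ⟨x, y, hxy, hI⟩ := hg
  by_cases hcol : (y c - y a) = (y b - y a) / (x b - x a) * (x c - x a)
  swap
  · exact ⟨x, y, hxy, hI, hcol⟩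
  have ht : ∀ v, Tendsto (fun ε : ℝ => Function.update y c (y c + ε) v) (𝓝[≠] 0) (𝓝 (y v)) := by
    intro v
    by_cases hv : v = c
    · subst hv
      simp only [Function.update_self]
      have : Tendsto (fun ε : ℝ => y v + ε) (𝓝 0) (𝓝 (y v + 0)) :=
        (continuous_const.add continuous_id).tendsto 0
      rw [add_zero] at this
      exact this.mono_left nhdsWithin_le_nhds
    · simp only [Function.update_of_ne hv]
      exact tendsto_const_nhds
  have e1 : ∀ᶠ ε : ℝ in 𝓝[≠] 0, CoM x (Function.update y c (y c + ε)) := by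
    unfold CoM
    refine eventually_all.2 fun v => eventually_all.2 fun w => eventually_imp_distrib_left.2 ?_
    intro hvw
    exact (tendsto_const_nhds.mul ((ht v).sub (ht w))).eventually_const_lt (hxy v w hvw)
  have e2 : ∀ᶠ ε : ℝ in 𝓝[≠] 0, IndW E (slo α x (Function.update y c (y c + ε))) := by
    refine indW_of_tendsto hI fun v w => ?_
    unfold slo
    exact (Real.continuousAt_rpow_const _ _ (Or.inr hα.le)).tendsto.comp
      (((ht v).sub (ht w)).div_const _)
  have e3 : ∀ᶠ ε : ℝ in 𝓝[≠] 0, ε ≠ 0 := eventually_mem_nhdsWithin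
  obtain ⟨ε, h1, h2, h3⟩ := (e1.and (e2.and e3)).exists
  refine ⟨x, _, h1, h2, ?_⟩
  rw [Function.update_self, Function.update_of_ne hac, Function.update_of_ne hbc, ← hcol]
  intro h
  apply h3
  linarith

theorem good_ext1 {V : Type} [Fintype V] {α : ℝ} (hα : 0 < α) {E : Finset (Sym2 V)} (v a b c : V)
    (hav : a ≠ v) (hbv : b ≠ v) (hcv : c ≠ v) (hab : a ≠ b) (hac : a ≠ c) (hbc : b ≠ c)
    (hv : ∀ w, s(v, w) ∈ E → w = a ∨ w = b ∨ w = c) (habE : s(a, b) ∉ E)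
    (hg : Good α (insert s(a, b) (E.filter (v ∉ ·)))) : Good α E := by
  obtain ⟨x, y, hxy, hI, hcol⟩ := noncol hα a b c hab hac hbc hg
  have hσ := hxy.slope_pos hab.symm
  set σ := (y b - y a) / (x b - x a) with hσd
  obtain ⟨X0, hX0⟩ := exists_gt x
  obtain ⟨Y0, hY0⟩ := exists_gt y
  obtain ⟨X, hX, hY⟩ : ∃ X, (∀ w, x w < X) ∧ (∀ w, y w < y a + σ * (X - x a)) := by
    refine ⟨max X0 (x a + (Y0 - y a) / σ), fun w => lt_of_lt_of_le (hX0 w) (le_max_left _ _),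
      fun w => lt_of_lt_of_le (hY0 w) ?_⟩
    have : (Y0 - y a) / σ ≤ max X0 (x a + (Y0 - y a) / σ) - x a := by
      linarith [le_max_right X0 (x a + (Y0 - y a) / σ)]
    rw [div_le_iff₀ hσ] at this
    linarith
  set Y := y a + σ * (X - x a) with hYd
  have hba : x b - x a ≠ 0 := sub_ne_zero.2 (hxy.ne hab.symm)
  have hσb : y b - y a = σ * (x b - x a) := by rw [hσd]; field_simp
  refine ⟨Function.update x v X, Function.update y v Y, com_update hxy v hX hY, ?_⟩
  set m := slo α (Function.update x v X) (Function.update y v Y) with hm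
  have hmeq : ∀ u w, u ≠ v → w ≠ v → m u w = slo α x y u w := by
    intro u w hu hw
    simp only [hm, slo, Function.update_of_ne hu, Function.update_of_ne hw]
  have hva : m v a = σ ^ α := by
    simp only [hm, slo, Function.update_self, Function.update_of_ne hav]
    congr 1
    rw [div_eq_iff (sub_pos.2 (hX a)).ne']; linarith
  have hvb : m v b = σ ^ α := by
    simp only [hm, slo, Function.update_self, Function.update_of_ne hbv]
    congr 1
    rw [div_eq_iff (sub_pos.2 (hX b)).ne']; linarith
  have hmab : m a b = σ ^ α := by
    rw [hmeq a b hav hbv, slo_symm]; rfl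
  have hmba : m b a = σ ^ α := by
    rw [hmeq b a hbv hav]; rfl
  have hvc : m v c ≠ σ ^ α := by
    simp only [hm, slo, Function.update_self, Function.update_of_ne hcv]
    intro h
    have := (Real.rpow_left_inj (div_pos (sub_pos.2 (hY c)) (sub_pos.2 (hX c))).le hσ.le
      hα.ne').1 h
    rw [div_eq_iff (sub_pos.2 (hX c)).ne'] at this
    apply hcol
    linarith
  have hms : ∀ u w, m u w = m w u := slo_symm α _ _
  have hI' : IndW (insert s(a, b) (E.filter (v ∉ ·))) m := by
    refine indW_congr ?_ hI
    intro u w huw _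
    have : u ≠ v ∧ w ≠ v := by
      rcases Finset.mem_insert.1 huw with h | h
      · rcases Sym2.eq_iff.1 h with ⟨rfl, rfl⟩ | ⟨rfl, rfl⟩
        · exact ⟨hav, hbv⟩
        · exact ⟨hbv, hav⟩
      · simp only [Finset.mem_filter, Sym2.mem_iff, not_or] at h
        exact ⟨Ne.symm h.2.1, Ne.symm h.2.2⟩
    exact (hmeq u w this.1 this.2).symm
  intro f h1 h2 h3 h4
  have hz0 : ∀ w, w ≠ a → w ≠ b → w ≠ c → f v w = 0 := fun w ha hb hc => h2 v w fun h => by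
    rcases hv w h with h | h | h <;> contradiction
  have e3 := h3 v
  have e4 := h4 v
  rw [sum_three _ hab hac hbc hz0] at e3
  rw [sum_three _ hab hac hbc (fun w ha hb hc => by rw [hz0 w ha hb hc, mul_zero]), hva, hvb] at e4
  have hfc : f v c = 0 := by
    have : (m v c - σ ^ α) * f v c = 0 := by linear_combination e4 - σ ^ α * e3
    rcases mul_eq_zero.1 this with h | h
    · exact absurd (sub_eq_zero.1 h) hvc
    · exact h
  have hfb : f v b = - f v a := by linarith
  have hzv : ∀ w, w ≠ a → w ≠ b → f w v = 0 := by
    intro w ha hb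
    have := h1 v w
    by_cases hc : w = c
    · rw [hc] at this ⊢; linarith
    · linarith [hz0 w ha hb hc]
  set t := f a v with ht
  have htb : f b v = - t := by linarith [h1 v b, h1 v a]
  have hvv : f v v = 0 := by linarith [h1 v v]
  have hfab : f a b = 0 := h2 a b habE
  have hfba : f b a = 0 := by linarith [h1 a b]
  let f' : V → V → ℝ := fun u w => if u = v ∨ w = v then 0 else
    if u = a ∧ w = b then t else if u = b ∧ w = a then -t else f u w
  have hf' : ∀ g : V → ℝ, ∀ u, u ≠ v → g v = g b ∨ u ≠ a → g v = g a ∨ u ≠ b →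
      ∑ w, g w * f' u w = ∑ w, g w * f u w := by
    intro g u hu hga hgb
    by_cases hua : u = a
    · have hg := hga.resolve_right (not_not.2 hua)
      rw [← sub_eq_zero, ← Finset.sum_sub_distrib, sum_two _ hbv]
      · simp [f', hua, hav, hbv, hg, hfab, ← ht]
      · intro w hw hw'
        have : ¬ (u = b ∧ w = a) := by rw [hua]; exact fun h => hab h.1
        simp [f', hu, hw, hw', this]
    by_cases hub : u = b
    · have hg := hgb.resolve_right (not_not.2 hub)
      rw [← sub_eq_zero, ← Finset.sum_sub_distrib, sum_two _ hav]
      · simp [f', hub, hav, hbv, hg, hfba, htb, hab.symm]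
      · intro w hw hw'
        simp [f', hu, hw, hw', hua]
    · refine Finset.sum_congr rfl fun w _ => ?_
      by_cases hw : w = v
      · simp [f', hw, hzv u hua hub]
      · simp [f', hw, hu, hua, hub]
  have hf0 : ∀ u w, f' u w = 0 := by
    refine hI' f' ?_ ?_ ?_ ?_
    · intro u w
      have := h1 u w
      simp only [f']
      split_ifs <;> grind
    · intro u w huw
      simp only [Finset.mem_insert, not_or, Finset.mem_filter, not_and, Sym2.mem_iff] at huw
      simp only [f']
      split_ifs with h5 h6 h7
      · rfl
      · exact absurd (by rw [h6.1, h6.2]) huw.1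
      · exact absurd (by rw [h7.1, h7.2, Sym2.eq_swap]) huw.1
      · refine h2 u w fun h => ?_
        have := huw.2 h
        grind
    · intro u
      by_cases hu : u = v
      · simp [f', hu]
      · have := hf' (fun _ => 1) u hu (Or.inl rfl) (Or.inl rfl)
        simp only [one_mul] at this
        rw [this, h3]
    · intro u
      by_cases hu : u = v
      · simp [f', hu]
      · rw [hf' (fun w => m u w) u hu ?_ ?_, h4]
        · by_cases hua : u = a
          · left; rw [hua, hms a v, hva, hmab]
          · right; exact hua
        · by_cases hub : u = b
          · left; rw [hub, hms b v, hvb, hmba]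
          · right; exact hub
  have ht0 : t = 0 := by
    have := hf0 a b
    simpa [f', hav, hbv] using this
  have hwv : ∀ w, f w v = 0 := by
    intro w
    by_cases ha : w = a
    · rw [ha, ← ht, ht0]
    by_cases hb : w = b
    · rw [hb, htb, ht0, neg_zero]
    exact hzv w ha hb
  intro u w
  by_cases hw : w = v
  · rw [hw]; exact hwv u
  by_cases hu : u = v
  · rw [hu]; linarith [h1 v w, hwv w]
  have := hf0 u w
  simp only [f', hu, hw, or_self, if_false] at this
  split_ifs at this with h5 h6
  · rw [h5.1, h5.2, hfab]
  · rw [h6.1, h6.2, hfba]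
  · exact this

theorem pow_mid {α : ℝ} (hα : 0 < α) (hα1 : α ≠ 1) : 1 + (3:ℝ) ^ α ≠ 2 * 2 ^ α := by
  rcases lt_or_gt_of_ne hα1 with h | h
  · obtain ⟨_, hh⟩ := Real.strictConcaveOn_rpow hα h
    have := hh (show (1:ℝ) ∈ Ici 0 by simp) (show (3:ℝ) ∈ Ici 0 by simp) (by norm_num)
      (show (0:ℝ) < 1/2 by norm_num) (show (0:ℝ) < 1/2 by norm_num) (by norm_num)
    simp only [smul_eq_mul, Real.one_rpow] at this
    norm_num at this
    intro h'
    linarith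
  · obtain ⟨_, hh⟩ := strictConvexOn_rpow h
    have := hh (show (1:ℝ) ∈ Ici 0 by simp) (show (3:ℝ) ∈ Ici 0 by simp) (by norm_num)
      (show (0:ℝ) < 1/2 by norm_num) (show (0:ℝ) < 1/2 by norm_num) (by norm_num)
    simp only [smul_eq_mul, Real.one_rpow] at this
    norm_num at this
    intro h'
    linarith

set_option maxHeartbeats 1000000 in
theorem good_K4 {V : Type} [Fintype V] {α : ℝ} (hα : 0 < α) (hα1 : α ≠ 1) {E : Finset (Sym2 V)}
    (v0 v1 v2 v3 : V) (h01 : v0 ≠ v1) (h02 : v0 ≠ v2) (h03 : v0 ≠ v3) (h12 : v1 ≠ v2)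
    (h13 : v1 ≠ v3) (h23 : v2 ≠ v3)
    (hE : ∀ u w, s(u, w) ∈ E → (w = v0 ∨ w = v1 ∨ w = v2 ∨ w = v3)) : Good α E := by
  let x : V → ℝ := fun v => if v = v0 then 0 else if v = v1 then 1 else if v = v2 then 2 else
    if v = v3 then 3 else 4 + ((Fintype.equivFin V v : ℕ) : ℝ)
  have hx0 : x v0 = 0 := by simp [x]
  have hx1 : x v1 = 1 := by simp [x, h01.symm]
  have hx2 : x v2 = 2 := by simp [x, h02.symm, h12.symm]
  have hx3 : x v3 = 3 := by simp [x, h03.symm, h13.symm, h23.symm]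
  have hxi : Function.Injective x := by
    intro u w h
    have p1 : (0:ℝ) ≤ ((Fintype.equivFin V u : ℕ) : ℝ) := by positivity
    have p2 : (0:ℝ) ≤ ((Fintype.equivFin V w : ℕ) : ℝ) := by positivity
    simp only [x] at h
    split_ifs at h <;> first | (subst_vars; rfl) | (exfalso; linarith) | skip
    simpa [Fin.val_inj] using h
  let g : ℝ → ℝ := fun s => max 0 (min 1 (s - 1))
  have hgm : Monotone g := fun s t hst => by
    simp only [g]; gcongr
  let y : ℝ → V → ℝ := fun δ v => δ * x v + g (x v)
  have hyt : ∀ v, Tendsto (fun δ => y δ v) (𝓝[>] 0) (𝓝 (g (x v))) := by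
    intro v
    have : Continuous fun δ => y δ v := by simp only [y]; fun_prop
    have h := this.tendsto 0
    simp only [y, zero_mul, zero_add] at h
    exact h.mono_left nhdsWithin_le_nhds
  have e2 : ∀ᶠ δ : ℝ in 𝓝[>] 0, IndW E (slo α x (y δ)) := by
    have : IndW E (slo α x (fun v => g (x v))) := by
      have m01 : slo α x (fun v => g (x v)) v0 v1 = 0 := by
        simp [slo, hx0, hx1, g, Real.zero_rpow hα.ne']
      have m23 : slo α x (fun v => g (x v)) v2 v3 = 0 := by
        simp only [slo, hx2, hx3, g]; norm_num [Real.zero_rpow hα.ne']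
      have m02 : slo α x (fun v => g (x v)) v0 v2 = (1/2) ^ α := by
        simp only [slo, hx2, hx0, g]; norm_num
      have m03 : slo α x (fun v => g (x v)) v0 v3 = (1/3) ^ α := by
        simp only [slo, hx3, hx0, g]; norm_num
      have m12 : slo α x (fun v => g (x v)) v1 v2 = 1 := by
        simp only [slo, hx2, hx1, g]; norm_num
      have m13 : slo α x (fun v => g (x v)) v1 v3 = (1/2) ^ α := by
        simp only [slo, hx3, hx1, g]; norm_num
      have hms := slo_symm α x (fun v => g (x v))
      set m := slo α x (fun v => g (x v)) with hm
      have n1 : (1/2 : ℝ) ^ α ≠ (1/3) ^ α := by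
        rw [Ne, Real.rpow_left_inj (by norm_num) (by norm_num) hα.ne']; norm_num
      have n2 : (1/2 : ℝ) ^ α ≠ 1 := by
        rw [← Real.one_rpow α, Ne, Real.rpow_left_inj (by norm_num) (by norm_num) hα.ne']; norm_num
      have n3 : (1/3 : ℝ) ^ α * (1 / 2) ^ α + (1/2) ^ α - 2 * (1/3) ^ α ≠ 0 := by
        have k2 : (1/2 : ℝ) ^ α = ((2:ℝ) ^ α)⁻¹ := by
          rw [one_div, Real.inv_rpow (by norm_num)]
        have k3 : (1/3 : ℝ) ^ α = ((3:ℝ) ^ α)⁻¹ := by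
          rw [one_div, Real.inv_rpow (by norm_num)]
        have hp2 : (0:ℝ) < 2 ^ α := by positivity
        have hp3 : (0:ℝ) < 3 ^ α := by positivity
        have hmain : 1 + (3:ℝ) ^ α ≠ 2 * 2 ^ α := pow_mid hα hα1
        rw [k2, k3]
        intro h
        apply hmain
        field_simp at h
        linarith
      intro f h1 h2 h3 h4
      have hz : ∀ u w, w ≠ v0 → w ≠ v1 → w ≠ v2 → w ≠ v3 → f u w = 0 := by
        intro u w a0 a1 a2 a3
        refine h2 u w fun h => ?_
        rcases hE u w h with h | h | h | h <;> contradiction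
      have hsum : ∀ k : V → ℝ, (∀ w, w ≠ v0 → w ≠ v1 → w ≠ v2 → w ≠ v3 → k w = 0) →
          ∑ w, k w = k v0 + k v1 + k v2 + k v3 := by
        intro k hk
        rw [← Finset.sum_subset (Finset.subset_univ {v0, v1, v2, v3})]
        · rw [Finset.sum_insert (by simp [*]), Finset.sum_insert (by simp [*]),
            Finset.sum_insert (by simp [*]), Finset.sum_singleton]
          ring
        · intro w _ hw
          simp only [Finset.mem_insert, Finset.mem_singleton, not_or] at hw
          exact hk w hw.1 hw.2.1 hw.2.2.1 hw.2.2.2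
      have hd : ∀ u, f u u = 0 := fun u => by linarith [h1 u u]
      have A : ∀ u, f u v0 + f u v1 + f u v2 + f u v3 = 0 := fun u => by
        rw [← h3 u, hsum _ (hz u)]
      have B : ∀ u, m u v0 * f u v0 + m u v1 * f u v1 + m u v2 * f u v2 + m u v3 * f u v3 = 0 :=
        fun u => by
        rw [← h4 u, hsum _ fun w a b c d => by rw [hz u w a b c d, mul_zero]]
      have A0 := A v0
      have A1 := A v1
      have A2 := A v2
      have A3 := A v3
      have B0 := B v0
      have B1 := B v1
      have B2 := B v2
      have B3 := B v3
      rw [hd] at A0 A1 A2 A3 B0 B1 B2 B3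
      rw [m01, m02, m03] at B0
      rw [hms v1 v0, m01, m12, m13] at B1
      rw [hms v2 v0, hms v2 v1, m02, m12, m23] at B2
      rw [hms v3 v0, hms v3 v1, hms v3 v2, m03, m13, m23] at B3
      have f10 : f v1 v0 = - f v0 v1 := by linarith [h1 v0 v1]
      have f20 : f v2 v0 = - f v0 v2 := by linarith [h1 v0 v2]
      have f30 : f v3 v0 = - f v0 v3 := by linarith [h1 v0 v3]
      have f21 : f v2 v1 = - f v1 v2 := by linarith [h1 v1 v2]
      have f31 : f v3 v1 = - f v1 v3 := by linarith [h1 v1 v3]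
      have f32 : f v3 v2 = - f v2 v3 := by linarith [h1 v2 v3]
      rw [f10] at A1 B1
      rw [f20, f21] at A2 B2
      rw [f30, f31, f32] at A3 B3
      set a := f v0 v1
      set b := f v0 v2
      set c := f v0 v3
      set d := f v1 v2
      set e := f v1 v3
      set k := f v2 v3
      set h := (1/2 : ℝ) ^ α
      set r := (1/3 : ℝ) ^ α
      have hh : h ≠ 0 := (by positivity : (0:ℝ) < h).ne'
      -- d = -h b, e = -d/h = b
      have hd' : d = - h * b := by linarith
      have he' : e = b := by
        have : h * e = h * b := by linarith
        exact mul_left_cancel₀ hh this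
      have hc' : r * c = - h * b := by linarith
      have ha' : a = d + e := by linarith
      have hb : b * (r * h + h - 2 * r) = 0 := by
        have : a * r = - (b * r) - r * c := by linear_combination r * A0
        rw [ha', hd', he', hc'] at this
        linear_combination (-1 : ℝ) * this
      have hb0 : b = 0 := (mul_eq_zero.1 hb).resolve_right n3
      have hd0 : d = 0 := by rw [hd', hb0, mul_zero]
      have he0 : e = 0 := by rw [he', hb0]
      have ha0 : a = 0 := by rw [ha', hd0, he0, add_zero]
      have hc0 : c = 0 := by linarith
      have hk0 : k = 0 := by linarith
      have hz' : ∀ u w, (w ≠ v0 ∧ w ≠ v1 ∧ w ≠ v2 ∧ w ≠ v3) → f w u = 0 := by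
        intro u w hw
        linarith [h1 u w, hz u w hw.1 hw.2.1 hw.2.2.1 hw.2.2.2]
      intro u w
      by_cases hw : w ≠ v0 ∧ w ≠ v1 ∧ w ≠ v2 ∧ w ≠ v3
      · exact hz u w hw.1 hw.2.1 hw.2.2.1 hw.2.2.2
      by_cases hu : u ≠ v0 ∧ u ≠ v1 ∧ u ≠ v2 ∧ u ≠ v3
      · exact hz' w u hu
      have hw' : w = v0 ∨ w = v1 ∨ w = v2 ∨ w = v3 := by tauto
      have hu' : u = v0 ∨ u = v1 ∨ u = v2 ∨ u = v3 := by tauto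
      have g10 := f10.trans (by rw [ha0, neg_zero])
      have g20 := f20.trans (by rw [hb0, neg_zero])
      have g30 := f30.trans (by rw [hc0, neg_zero])
      have g21 := f21.trans (by rw [hd0, neg_zero])
      have g31 := f31.trans (by rw [he0, neg_zero])
      have g32 := f32.trans (by rw [hk0, neg_zero])
      rcases hu' with hu' | hu' | hu' | hu' <;> rcases hw' with hw' | hw' | hw' | hw' <;>
        rw [hu', hw'] <;> first | exact hd _ | assumption
    refine indW_of_tendsto this fun v w => ?_
    unfold slo
    exact (Real.continuousAt_rpow_const _ _ (Or.inr hα.le)).tendsto.comp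
      (((hyt v).sub (hyt w)).div_const _)
  have e3 : ∀ᶠ δ : ℝ in 𝓝[>] 0, 0 < δ := eventually_mem_nhdsWithin
  obtain ⟨δ, hI, hδ⟩ := (e2.and e3).exists
  refine ⟨x, y δ, CoM.symm_left (fun v w _ h => ?_) hxi, hI⟩
  simp only [y]
  have := hgm h.le
  have := mul_lt_mul_of_pos_left h hδ
  linarith

/-- The contraction of `U` to `u0`. -/
def ctr {V : Type} (U : Finset V) (u0 v : V) : V := if v ∈ U then u0 else v

theorem indW_contract {V : Type} [Fintype V] {E : Finset (Sym2 V)} (U : Finset V) (u0 : V)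
    (hu0 : u0 ∈ U) (hinj : Set.InjOn (Sym2.map (ctr U u0)) (E \ U.sym2 : Finset (Sym2 V)))
    {m0 m1 : V → V → ℝ} (hs1 : ∀ v w, m1 v w = m1 w v)
    (h0 : IndW ((E \ U.sym2).image (Sym2.map (ctr U u0))) m0) (h1 : IndW (E ∩ U.sym2) m1) :
    IndW E (fun v w => if v ∈ U ∧ w ∈ U then m1 v w else m0 (ctr U u0 v) (ctr U u0 w)) := by
  set c := ctr U u0 with hc
  set ms : V → V → ℝ := fun v w => if v ∈ U ∧ w ∈ U then m1 v w else m0 (c v) (c w) with hms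
  have hmem : ∀ v w, s(v, w) ∈ U.sym2 ↔ v ∈ U ∧ w ∈ U := fun v w => by
    simp
  intro f f1 f2 f3 f4
  let g : V → V → ℝ := fun v w => if v ∈ U ∧ w ∈ U then 0 else f v w
  let f' : V → V → ℝ := fun a b => ∑ v, ∑ w, if c v = a ∧ c w = b then g v w else 0
  have g1 : ∀ v w, g v w + g w v = 0 := by
    intro v w
    simp only [g]
    have := f1 v w
    split_ifs <;> first | linarith | tauto
  have gE : ∀ v w, s(v, w) ∉ E \ U.sym2 → g v w = 0 := by
    intro v w h
    simp only [g]
    split_ifs with h'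
    · rfl
    · exact f2 v w fun hE => h (Finset.mem_sdiff.2 ⟨hE, by rwa [hmem]⟩)
  -- node sums of g
  have anti : ∀ k : V → V → ℝ, (∀ v w, k v w = k w v) →
      ∑ v ∈ U, ∑ w ∈ U, k v w * f v w = 0 := by
    intro k hk
    have e : ∑ v ∈ U, ∑ w ∈ U, k v w * f v w = - ∑ v ∈ U, ∑ w ∈ U, k v w * f v w := by
      conv_lhs => rw [Finset.sum_comm]
      rw [← Finset.sum_neg_distrib]
      refine Finset.sum_congr rfl fun v _ => ?_
      rw [← Finset.sum_neg_distrib]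
      refine Finset.sum_congr rfl fun w _ => ?_
      rw [hk w v]
      have := f1 v w
      linear_combination (k v w) * this
    linarith
  have node : ∀ k : V → V → ℝ, (∀ v w, v ∈ U → w ∈ U → k v w = k w v) →
      (∀ v, ∑ w, k v w * f v w = 0) →
      ∀ a, ∑ v, (if c v = a then ∑ w, k v w * g v w else 0) = 0 := by
    intro k hk hk0 a
    have e1 : ∀ v, ∑ w, k v w * g v w = - if v ∈ U then ∑ w ∈ U, k v w * f v w else 0 := by
      intro v
      have : ∑ w, k v w * g v w =
          ∑ w, k v w * f v w - ∑ w, if v ∈ U ∧ w ∈ U then k v w * f v w else 0 := by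
        rw [← Finset.sum_sub_distrib]
        refine Finset.sum_congr rfl fun w _ => ?_
        simp only [g]
        split_ifs <;> ring
      rw [this, hk0, zero_sub]
      congr 1
      split_ifs with hv
      · simp [hv, ← Finset.sum_filter]
      · simp [hv]
    simp_rw [e1]
    by_cases ha : a = u0
    · have e2 : ∀ v, (if c v = a then - (if v ∈ U then ∑ w ∈ U, k v w * f v w else 0) else 0) =
          if v ∈ U then - ∑ w ∈ U, k v w * f v w else 0 := by
        intro v
        by_cases hv : v ∈ U
        · have : c v = a := by simp [hc, ctr, hv, ha]
          simp [hv, this]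
        · simp [hv]
      simp_rw [e2]
      rw [← Finset.sum_filter]
      simp only [Finset.filter_univ_mem, Finset.sum_neg_distrib, neg_eq_zero]
      have := anti (fun v w => if v ∈ U ∧ w ∈ U then k v w else 0) (fun v w => by
        by_cases h : v ∈ U ∧ w ∈ U
        · rw [if_pos h, if_pos h.symm, hk v w h.1 h.2]
        · rw [if_neg h, if_neg (fun h' => h h'.symm)])
      rw [← this]
      refine Finset.sum_congr rfl fun v hv => Finset.sum_congr rfl fun w hw => ?_
      rw [if_pos ⟨hv, hw⟩]
    · refine Finset.sum_eq_zero fun v _ => ?_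
      split_ifs with h h'
      · exact absurd (by rw [← h]; simp [hc, ctr, h']) ha
      · simp
      · rfl
  have push : ∀ k : V → V → ℝ, ∀ a,
      ∑ b, k a b * f' a b = ∑ v, (if c v = a then ∑ w, k (c v) (c w) * g v w else 0) := by
    intro k a
    simp only [f', Finset.mul_sum]
    rw [Finset.sum_comm]
    refine Finset.sum_congr rfl fun v _ => ?_
    rw [Finset.sum_comm]
    split_ifs with h
    · refine Finset.sum_congr rfl fun w _ => ?_
      rw [Fintype.sum_eq_single (c w)]
      · simp [h]
      · intro b hb
        rw [if_neg (fun h' => hb h'.2.symm), mul_zero]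
    · refine Finset.sum_eq_zero fun w _ => Finset.sum_eq_zero fun b _ => ?_
      rw [if_neg (fun h' => h h'.1), mul_zero]
  have hf' : ∀ a b, f' a b = 0 := by
    refine h0 f' ?_ ?_ ?_ ?_
    · intro a b
      simp only [f']
      conv_lhs => rw [Finset.sum_comm (s := Finset.univ) (t := Finset.univ)
        (f := fun v w => if c v = b ∧ c w = a then g v w else 0)]
      rw [← Finset.sum_add_distrib]
      refine Finset.sum_eq_zero fun v _ => ?_
      rw [← Finset.sum_add_distrib]
      refine Finset.sum_eq_zero fun w _ => ?_
      have := g1 v w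
      by_cases h : c v = a ∧ c w = b
      · rw [if_pos h, if_pos h.symm, this]
      · rw [if_neg h, if_neg (fun h' => h h'.symm), add_zero]
    · intro a b hab
      refine Finset.sum_eq_zero fun v _ => Finset.sum_eq_zero fun w _ => ?_
      split_ifs with h
      · refine gE v w fun hE => hab ?_
        refine Finset.mem_image.2 ⟨s(v, w), hE, ?_⟩
        simp [h.1, h.2]
      · rfl
    · intro a
      have := push (fun _ _ => 1) a
      simp only [one_mul] at this
      rw [this]
      have := node (fun _ _ => 1) (fun _ _ _ _ => rfl) (by simpa using f3) a
      simpa using this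
    · intro a
      rw [push m0 a]
      have := node ms (fun v w hv hw => by simp [hms, hv, hw, hs1 v w]) f4 a
      refine Eq.trans ?_ this
      refine Finset.sum_congr rfl fun v _ => ?_
      split_ifs with h
      · refine Finset.sum_congr rfl fun w _ => ?_
        simp only [hms, g]
        split_ifs <;> simp
      · rfl
  have hg0 : ∀ v w, g v w = 0 := by
    intro v w
    by_contra hne
    have hvw : s(v, w) ∈ E \ U.sym2 := by
      by_contra h
      exact hne (gE v w h)
    have hvwne : v ≠ w := by
      rintro rfl
      apply hne; linarith [g1 v v]
    have : f' (c v) (c w) = g v w := by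
      simp only [f']
      rw [Fintype.sum_eq_single v, Fintype.sum_eq_single w]
      · simp
      · intro w' hw'
        split_ifs with h
        · by_contra hne'
          have h' : s(v, w') ∈ E \ U.sym2 := by
            by_contra h
            exact hne' (gE v w' h)
          have := hinj h' hvw (by simp [h.2])
          rcases Sym2.eq_iff.1 this with h | h
          · exact hw' h.2
          · exact hvwne h.1
        · rfl
      · intro v' hv'
        refine Finset.sum_eq_zero fun w' _ => ?_
        split_ifs with h
        · by_contra hne'
          have h' : s(v', w') ∈ E \ U.sym2 := by
            by_contra h
            exact hne' (gE v' w' h)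
          have := hinj h' hvw (by simp [h.2, h.1])
          rcases Sym2.eq_iff.1 this with h5 | h5
          · exact hv' h5.1
          · have h6 := h.1
            rw [h5.1] at h6
            have h7 := (Finset.mem_sdiff.1 hvw).2
            rw [hmem] at h7
            apply h7
            simp only [hc, ctr] at h6
            split_ifs at h6 with a1 a2 a2
            · exact ⟨a2, a1⟩
            · exact absurd (h6 ▸ hu0) a2
            · exact absurd (h6 ▸ hu0) a1
            · exact absurd h6.symm hvwne
        · rfl
    rw [hf'] at this
    exact hne this.symm
  have hI : IndW (E ∩ U.sym2) ms := by
    refine indW_congr ?_ h1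
    intro v w h _
    have := (hmem v w).1 (Finset.mem_inter.1 h).2
    simp only [hms]
    rw [if_pos this]
  refine hI f f1 ?_ f3 f4
  intro v w h
  by_cases h' : v ∈ U ∧ w ∈ U
  · exact f2 v w fun hE => h (Finset.mem_inter.2 ⟨hE, (hmem v w).2 h'⟩)
  · have := hg0 v w
    simpa only [g, if_neg h'] using this

theorem good_contract {V : Type} [Fintype V] {α : ℝ} (hα : 0 < α) {E : Finset (Sym2 V)}
    (U : Finset V) (u0 : V)
    (hu0 : u0 ∈ U) (hinj : Set.InjOn (Sym2.map (ctr U u0)) (E \ U.sym2 : Finset (Sym2 V)))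
    (h0 : Good α ((E \ U.sym2).image (Sym2.map (ctr U u0)))) (h1 : Good α (E ∩ U.sym2)) :
    Good α E := by
  obtain ⟨x0, y0, hc0, hI0⟩ := h0
  obtain ⟨x1, y1, hc1, hI1⟩ := h1
  have hI := indW_contract U u0 hu0 hinj (slo_symm α x1 y1) hI0 hI1
  let pl : (V → ℝ) → (V → ℝ) → ℝ → V → ℝ := fun z0 z1 δ v =>
    if v ∈ U then z0 u0 + δ * z1 v else z0 v
  have hpl : ∀ z0 z1 v, Tendsto (fun δ => pl z0 z1 δ v) (𝓝[>] 0) (𝓝 (z0 (ctr U u0 v))) := by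
    intro z0 z1 v
    have : Continuous fun δ => pl z0 z1 δ v := by
      simp only [pl]
      split_ifs <;> fun_prop
    have h := this.tendsto 0
    have e : pl z0 z1 0 v = z0 (ctr U u0 v) := by
      simp only [pl, ctr]; split_ifs <;> simp
    rw [e] at h
    exact h.mono_left nhdsWithin_le_nhds
  have hpos : ∀ᶠ δ : ℝ in 𝓝[>] 0, 0 < δ := eventually_mem_nhdsWithin
  have e1 : ∀ᶠ δ : ℝ in 𝓝[>] 0, CoM (pl x0 x1 δ) (pl y0 y1 δ) := by
    unfold CoM
    refine eventually_all.2 fun v => eventually_all.2 fun w => eventually_imp_distrib_left.2 ?_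
    intro hvw
    by_cases h : v ∈ U ∧ w ∈ U
    · filter_upwards [hpos] with δ hδ
      simp only [pl, if_pos h.1, if_pos h.2]
      have := mul_pos (mul_pos hδ hδ) (hc1 v w hvw)
      linarith
    · have hne : ctr U u0 v ≠ ctr U u0 w := by
        unfold ctr
        split_ifs with a b b
        · exact absurd ⟨a, b⟩ h
        · rintro rfl; exact b hu0
        · rintro rfl; exact a hu0
        · exact hvw
      exact (((hpl x0 x1 v).sub (hpl x0 x1 w)).mul
        ((hpl y0 y1 v).sub (hpl y0 y1 w))).eventually_const_lt (hc0 _ _ hne)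
  have e2 : ∀ᶠ δ : ℝ in 𝓝[>] 0, IndW E (slo α (pl x0 x1 δ) (pl y0 y1 δ)) := by
    refine indW_of_tendsto hI fun v w => ?_
    split_ifs with h
    · refine tendsto_const_nhds.congr' ?_
      filter_upwards [hpos] with δ hδ
      simp only [slo, pl, if_pos h.1, if_pos h.2, add_sub_add_left_eq_sub, ← mul_sub]
      rw [mul_div_mul_left _ _ hδ.ne']
    · by_cases hvw : v = w
      · subst hvw
        simp only [slo, sub_self]
        exact tendsto_const_nhds
      have hne : ctr U u0 v ≠ ctr U u0 w := by
        unfold ctr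
        split_ifs with a b b
        · exact absurd ⟨a, b⟩ h
        · rintro rfl; exact b hu0
        · rintro rfl; exact a hu0
        · exact hvw
      unfold slo
      exact (Real.continuousAt_rpow_const _ _ (Or.inr hα.le)).tendsto.comp
        (((hpl y0 y1 v).sub (hpl y0 y1 w)).div ((hpl x0 x1 v).sub (hpl x0 x1 w))
          (sub_ne_zero.2 (hc0.ne hne)))
  obtain ⟨δ, a, b⟩ := (e1.and e2).exists
  exact ⟨_, _, a, b⟩

/-- The number of edges induced by `U`. -/
def ie {V : Type} (E : Finset (Sym2 V)) (U : Finset V) : ℕ := (E ∩ U.sym2).card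

/-- Sparsity of an edge set. -/
def Sprs {V : Type} (l : ℕ) (E : Finset (Sym2 V)) : Prop :=
  ∀ U : Finset V, 2 ≤ U.card → ie E U + l ≤ 2 * U.card

/-- No loops. -/
def Lpl {V : Type} (E : Finset (Sym2 V)) : Prop := ∀ v w, s(v, w) ∈ E → v ≠ w

/-- Neighbours. -/
def nb {V : Type} [Fintype V] (E : Finset (Sym2 V)) (v : V) : Finset V :=
  Finset.univ.filter (fun w => s(v, w) ∈ E)

theorem mem_nb {V : Type} [Fintype V] {E : Finset (Sym2 V)} {v w : V} :
    w ∈ nb E v ↔ s(v, w) ∈ E := by simp [nb]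

theorem mem_nb' {V : Type} [Fintype V] {E : Finset (Sym2 V)} {v w : V} :
    w ∈ nb E v ↔ v ∈ nb E w := by simp [nb, Sym2.eq_swap]

theorem ie_mono {V : Type} {E E' : Finset (Sym2 V)} (h : E ⊆ E') (U : Finset V) :
    ie E U ≤ ie E' U := Finset.card_le_card (Finset.inter_subset_inter_right h)

theorem ie_small {V : Type} {E : Finset (Sym2 V)} (hE : Lpl E) {U : Finset V} (hU : U.card ≤ 1) :
    ie E U = 0 := by
  rw [ie, Finset.card_eq_zero, Finset.eq_empty_iff_forall_notMem]
  intro e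
  induction e with
  | _ v w =>
    intro h
    rw [Finset.mem_inter, Finset.mk_mem_sym2_iff] at h
    exact hE v w h.1 (Finset.card_le_one.1 hU v h.2.1 w h.2.2)

theorem ie_super {V : Type} (E : Finset (Sym2 V)) (A B : Finset V) :
    ie E A + ie E B ≤ ie E (A ∪ B) + ie E (A ∩ B) := by
  unfold ie
  rw [← Finset.card_union_add_card_inter]
  refine Nat.add_le_add (Finset.card_le_card ?_) (Finset.card_le_card ?_)
  · intro e
    induction e with
    | _ v w =>
      simp only [Finset.mem_union, Finset.mem_inter, Finset.mk_mem_sym2_iff]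
      tauto
  · intro e
    induction e with
    | _ v w =>
      simp only [Finset.mem_inter, Finset.mk_mem_sym2_iff]
      tauto

theorem ie_insert {V : Type} [Fintype V] {E : Finset (Sym2 V)} (hE : Lpl E) {U : Finset V} {v : V}
    (hv : v ∉ U) : ie E (insert v U) = ie E U + (nb E v ∩ U).card := by
  have h1 : E ∩ (insert v U).sym2 = (E ∩ U.sym2) ∪ (nb E v ∩ U).image (fun w => s(v, w)) := by
    ext e
    induction e with
    | _ a b =>
      simp only [Finset.mem_inter, Finset.mk_mem_sym2_iff, Finset.mem_union, Finset.mem_insert,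
        Finset.mem_image, mem_nb, Sym2.eq_iff]
      constructor
      · rintro ⟨h, ha | ha, hb | hb⟩
        · exact absurd (ha.trans hb.symm) (hE a b h)
        · exact Or.inr ⟨b, ⟨by rwa [← ha], hb⟩, Or.inl ⟨ha.symm, rfl⟩⟩
        · exact Or.inr ⟨a, ⟨by rwa [← hb, Sym2.eq_swap], ha⟩, Or.inr ⟨hb.symm, rfl⟩⟩
        · exact Or.inl ⟨h, ha, hb⟩
      · rintro (⟨h, ha, hb⟩ | ⟨w, ⟨h, hw⟩, ⟨rfl, rfl⟩ | ⟨rfl, rfl⟩⟩)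
        · exact ⟨h, Or.inr ha, Or.inr hb⟩
        · exact ⟨h, Or.inl rfl, Or.inr hw⟩
        · exact ⟨by rwa [Sym2.eq_swap], Or.inr hw, Or.inl rfl⟩
  unfold ie
  rw [h1, Finset.card_union_of_disjoint, Finset.card_image_of_injective]
  · intro a b h
    exact Sym2.congr_right.1 h
  · rw [Finset.disjoint_left]
    intro e he
    induction e with
    | _ a b =>
      simp only [Finset.mem_inter, Finset.mk_mem_sym2_iff, Finset.mem_image, Sym2.eq_iff] at he ⊢
      rintro ⟨w, _, ⟨h, _⟩ | ⟨h, _⟩⟩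
      · exact hv (h ▸ he.2.1)
      · exact hv (h ▸ he.2.2)

/-- The support. -/
def supp {V : Type} [Fintype V] (E : Finset (Sym2 V)) : Finset V :=
  Finset.univ.filter (fun v => (nb E v).Nonempty)

theorem mem_supp {V : Type} [Fintype V] {E : Finset (Sym2 V)} {v w : V} (h : s(v, w) ∈ E) :
    v ∈ supp E ∧ w ∈ supp E := by
  simp only [supp, Finset.mem_filter, Finset.mem_univ, true_and]
  exact ⟨⟨w, mem_nb.2 h⟩, ⟨v, mem_nb.2 (by rwa [Sym2.eq_swap])⟩⟩

theorem sum_nb {V : Type} [Fintype V] {E : Finset (Sym2 V)} (hE : Lpl E) :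
    ∑ v, (nb E v).card = 2 * E.card := by
  have h1 : ∀ v, (nb E v).card = (E.filter (v ∈ ·)).card := by
    intro v
    refine Finset.card_bij (fun w _ => s(v, w)) ?_ ?_ ?_
    · intro w hw
      simp [mem_nb.1 hw]
    · intro a _ b _ h
      exact Sym2.congr_right.1 h
    · intro e he
      simp only [Finset.mem_filter] at he
      obtain ⟨w, rfl⟩ := he.2
      exact ⟨w, mem_nb.2 he.1, rfl⟩
  simp_rw [h1, Finset.card_filter]
  rw [Finset.sum_comm]
  rw [Finset.sum_const_nat (m := 2), mul_comm]
  intro e he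
  induction e with
  | _ a b =>
    have hab := hE a b he
    rw [← Finset.card_filter]
    have : (Finset.univ.filter (fun i => i ∈ s(a, b))) = {a, b} := by
      ext i; simp
    rw [this, Finset.card_pair hab]

theorem exists_low {V : Type} [Fintype V] {E : Finset (Sym2 V)} (hE : Lpl E) {l : ℕ} (hl : 1 ≤ l)
    (hS : Sprs l E) (hne : E.Nonempty) : ∃ v, 1 ≤ (nb E v).card ∧ (nb E v).card ≤ 3 := by
  by_contra hcon
  push Not at hcon
  have h1 : ∑ v ∈ supp E, 4 ≤ ∑ v ∈ supp E, (nb E v).card := by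
    refine Finset.sum_le_sum fun v hv => ?_
    have := hcon v (Finset.card_pos.2 (by simpa [supp] using hv))
    omega
  have h2 : ∑ v ∈ supp E, (nb E v).card ≤ ∑ v, (nb E v).card :=
    Finset.sum_le_sum_of_subset (Finset.subset_univ _)
  rw [sum_nb hE] at h2
  simp only [Finset.sum_const, smul_eq_mul] at h1
  have h3 : 2 ≤ (supp E).card := by
    obtain ⟨e, he⟩ := hne
    induction e with
    | _ a b =>
      have := mem_supp he
      exact Finset.one_lt_card.2 ⟨a, this.1, b, this.2, hE a b he⟩
  have h4 := hS _ h3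
  have h5 : ie E (supp E) = E.card := by
    unfold ie
    congr 1
    rw [Finset.inter_eq_left]
    intro e he
    induction e with
    | _ a b =>
      rw [Finset.mk_mem_sym2_iff]
      exact mem_supp he
  omega

theorem sprs_mono {V : Type} {l : ℕ} {E E' : Finset (Sym2 V)} (h : E ⊆ E') (hS : Sprs l E') :
    Sprs l E := fun U hU => by have := hS U hU; have := ie_mono h U; omega

theorem lpl_mono {V : Type} {E E' : Finset (Sym2 V)} (h : E ⊆ E') (hS : Lpl E') :
    Lpl E := fun v w hvw => hS v w (h hvw)

theorem ie_del {V : Type} {E : Finset (Sym2 V)} {v : V} (U : Finset V) :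
    ie (E.filter (v ∉ ·)) U = ie E (U.erase v) := by
  unfold ie
  congr 1
  ext e
  induction e with
  | _ a b =>
    simp only [Finset.mem_inter, Finset.mk_mem_sym2_iff, Finset.mem_filter, Sym2.mem_iff,
      Finset.mem_erase]
    grind

theorem pair_tight {V : Type} {E : Finset (Sym2 V)} {l : ℕ}
    (hS : Sprs l E) {v a b : V} (hav : a ≠ v) (hbv : b ≠ v) (hab : a ≠ b)
    (hn : ¬ Sprs l (insert s(a, b) (E.filter (v ∉ ·)))) :
    ∃ U : Finset V, a ∈ U ∧ b ∈ U ∧ v ∉ U ∧ 2 * U.card ≤ ie E U + l := by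
  unfold Sprs at hn
  push Not at hn
  obtain ⟨U, hU2, hU⟩ := hn
  have hd := ie_del (E := E) (v := v) U
  have hle : ie (E.filter (v ∉ ·)) U ≤ ie E U := ie_mono (Finset.filter_subset _ _) U
  have h0 := hS U hU2
  by_cases hin : a ∈ U ∧ b ∈ U
  · have h1 : ie (insert s(a, b) (E.filter (v ∉ ·))) U ≤ ie (E.filter (v ∉ ·)) U + 1 := by
      unfold ie
      rw [Finset.insert_inter_of_mem (by simpa using hin)]
      exact Finset.card_insert_le _ _
    refine ⟨U, hin.1, hin.2, ?_, by omega⟩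
    intro hv
    have h2 : 2 ≤ (U.erase v).card := Finset.one_lt_card.2
      ⟨a, Finset.mem_erase.2 ⟨hav, hin.1⟩, b, Finset.mem_erase.2 ⟨hbv, hin.2⟩, hab⟩
    have := hS _ h2
    have := Finset.card_erase_of_mem hv
    omega
  · have h1 : ie (insert s(a, b) (E.filter (v ∉ ·))) U = ie (E.filter (v ∉ ·)) U := by
      unfold ie
      rw [Finset.insert_inter_of_notMem (by simpa using hin)]
    omega

theorem lpl_insert {V : Type} {E : Finset (Sym2 V)} (hE : Lpl E) {v a b : V} (hab : a ≠ b) :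
    Lpl (insert s(a, b) (E.filter (v ∉ ·))) := by
  intro u w h
  rcases Finset.mem_insert.1 h with h | h
  · rcases Sym2.eq_iff.1 h with ⟨rfl, rfl⟩ | ⟨rfl, rfl⟩
    · exact hab
    · exact hab.symm
  · exact hE u w (Finset.mem_filter.1 h).1

/-- Deleting a vertex removes its edges. -/
theorem card_del {V : Type} [Fintype V] {E : Finset (Sym2 V)} (v : V) :
    (E.filter (v ∉ ·)).card + (nb E v).card = E.card := by
  rw [← Finset.card_filter_add_card_filter_not (s := E) (v ∈ ·), add_comm]
  congr 1
  refine Finset.card_bij (fun w _ => s(v, w)) ?_ ?_ ?_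
  · intro w hw
    simp [mem_nb.1 hw]
  · intro a _ b _ h
    exact Sym2.congr_right.1 h
  · intro e he
    simp only [Finset.mem_filter] at he
    obtain ⟨w, rfl⟩ := he.2
    exact ⟨w, mem_nb.2 he.1, rfl⟩

theorem step_low {V : Type} [Fintype V] {α : ℝ} (hα : 0 < α) {E : Finset (Sym2 V)} (hE : Lpl E)
    (v : V) (h1 : 1 ≤ (nb E v).card) (h2 : (nb E v).card ≤ 2)
    (hg : Good α (E.filter (v ∉ ·))) : Good α E := by
  have hlp : ∀ w, w ∈ nb E v → w ≠ v := fun w hw => (hE v w (mem_nb.1 hw)).symm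
  rcases (by omega : (nb E v).card = 1 ∨ (nb E v).card = 2) with h | h
  · obtain ⟨a, ha⟩ := Finset.card_eq_one.1 h
    have hav := hlp a (by simp [ha])
    refine good_ext0 hα v a a hav hav ?_ hg
    intro w hw
    rw [← mem_nb, ha] at hw
    simpa using hw
  · obtain ⟨a, b, hab, ha⟩ := Finset.card_eq_two.1 h
    have hav := hlp a (by simp [ha])
    have hbv := hlp b (by simp [ha])
    refine good_ext0 hα v a b hav hbv ?_ hg
    intro w hw
    rw [← mem_nb, ha] at hw
    simpa using hw

/-- Data of a degree three vertex. -/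
theorem step_three {V : Type} [Fintype V] {α : ℝ} (hα : 0 < α) {E : Finset (Sym2 V)} (hE : Lpl E)
    {l : ℕ} (hS : Sprs l E)
    (hg : ∀ E' : Finset (Sym2 V), E'.card < E.card → Lpl E' → Sprs l E' → Good α E')
    (v a b c : V) (hab : a ≠ b) (hac : a ≠ c) (hbc : b ≠ c) (hnb : nb E v = {a, b, c}) :
    Good α E ∨ s(a, b) ∈ E ∨
      ∃ U : Finset V, a ∈ U ∧ b ∈ U ∧ v ∉ U ∧ 2 * U.card ≤ ie E U + l := by
  have hlp : ∀ w, w ∈ nb E v → w ≠ v := fun w hw => (hE v w (mem_nb.1 hw)).symm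
  have hav := hlp a (by simp [hnb])
  have hbv := hlp b (by simp [hnb])
  have hcv := hlp c (by simp [hnb])
  by_cases h : s(a, b) ∈ E
  · exact Or.inr (Or.inl h)
  by_cases hs : Sprs l (insert s(a, b) (E.filter (v ∉ ·)))
  · left
    refine good_ext1 hα v a b c hav hbv hcv hab hac hbc ?_ h (hg _ ?_ (lpl_insert hE hab) hs)
    · intro w hw
      rw [← mem_nb, hnb] at hw
      simpa using hw
    · have h1 := card_del (E := E) v
      have h2 := Finset.card_insert_le s(a, b) (E.filter (v ∉ ·))
      have h3 : (nb E v).card = 3 := Finset.card_eq_three.2 ⟨a, b, c, hab, hac, hbc, hnb⟩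
      omega
  · exact Or.inr (Or.inr (pair_tight hS hav hbv hab hs))

theorem ie_pair {V : Type} {E : Finset (Sym2 V)} {U : Finset V} {a b : V} (h : s(a, b) ∈ E)
    (ha : a ∈ U) (hb : b ∈ U) : 1 ≤ ie E U :=
  Finset.card_pos.2 ⟨s(a, b), by simp [h, ha, hb]⟩

theorem good_laman {V : Type} [Fintype V] {α : ℝ} (hα : 0 < α) : ∀ (n : ℕ) (E : Finset (Sym2 V)),
    E.card = n → Lpl E → Sprs 3 E → Good α E := by
  intro n
  induction n using Nat.strong_induction_on with
  | _ n ih =>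
  intro E hn hE hS
  have hg : ∀ E' : Finset (Sym2 V), E'.card < E.card → Lpl E' → Sprs 3 E' → Good α E' :=
    fun E' h1 h2 h3 => ih _ (hn ▸ h1) E' rfl h2 h3
  rcases E.eq_empty_or_nonempty with rfl | hne
  · exact good_empty α
  obtain ⟨v, h1, h3⟩ := exists_low hE (by norm_num) hS hne
  rcases (by omega : (nb E v).card ≤ 2 ∨ (nb E v).card = 3) with h2 | h2
  · refine step_low hα hE v h1 h2 (hg _ ?_ (lpl_mono (Finset.filter_subset _ _) hE)
      (sprs_mono (Finset.filter_subset _ _) hS))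
    have := card_del (E := E) v
    omega
  obtain ⟨a, b, c, hab, hac, hbc, hnb⟩ := Finset.card_eq_three.1 h2
  have hlp : ∀ w, w ∈ nb E v → w ≠ v := fun w hw => (hE v w (mem_nb.1 hw)).symm
  have hav := hlp a (by simp [hnb])
  have hbv := hlp b (by simp [hnb])
  have hcv := hlp c (by simp [hnb])
  by_contra hcon
  have key : ∀ a b c : V, a ≠ b → a ≠ c → b ≠ c → nb E v = {a, b, c} → 
      ∃ U : Finset V, a ∈ U ∧ b ∈ U ∧ v ∉ U ∧ 2 * U.card ≤ ie E U + 3 := by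
    intro a b c hab hac hbc hnb
    rcases step_three hα hE hS hg v a b c hab hac hbc hnb with h | h | h
    · exact absurd h hcon
    · refine ⟨{a, b}, by simp, by simp, ?_, ?_⟩
      · have hav := hlp a (by simp [hnb])
        have hbv := hlp b (by simp [hnb])
        simp [hav.symm, hbv.symm]
      · have := ie_pair (U := {a, b}) h (by simp) (by simp)
        rw [Finset.card_pair hab]
        omega
    · exact h
  obtain ⟨A, aA, bA, vA, hA⟩ := key a b c hab hac hbc hnb
  obtain ⟨B, bB, cB, vB, hB⟩ := key b c a hbc hab.symm hac.symm (by rw [hnb]; grind)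
  obtain ⟨C, aC, cC, vC, hC⟩ := key a c b hac hab hbc.symm (by rw [hnb]; grind)
  have bad : ∀ W : Finset V, a ∈ W → b ∈ W → c ∈ W → v ∉ W → ie E W + 4 ≤ 2 * W.card := by
    intro W ha hb hc hv
    have e1 := ie_insert hE hv
    have e2 : nb E v ∩ W = nb E v := by
      rw [Finset.inter_eq_left, hnb]
      intro w hw
      simp only [Finset.mem_insert, Finset.mem_singleton] at hw
      rcases hw with rfl | rfl | rfl <;> assumption
    rw [e2, h2] at e1
    have e3 := Finset.card_insert_of_notMem hv
    have e4 : 1 ≤ W.card := Finset.card_pos.2 ⟨a, ha⟩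
    have := hS (insert v W) (by omega)
    omega
  have union : ∀ A B : Finset V, 2 * A.card ≤ ie E A + 3 → 2 * B.card ≤ ie E B + 3 →
      a ∈ A ∪ B → b ∈ A ∪ B → c ∈ A ∪ B → v ∉ A → v ∉ B → (A ∩ B).card ≤ 1 := by
    intro A B hA hB h1 h2 h3 vA vB
    by_contra hc
    have e1 := bad (A ∪ B) h1 h2 h3 (by simp [vA, vB])
    have e2 := ie_super E A B
    have e3 := Finset.card_union_add_card_inter A B
    have e4 := hS (A ∩ B) (by omega)
    omega
  have iAB := union A B hA hB (by simp [aA]) (by simp [bA]) (by simp [cB]) vA vB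
  have iAC := union A C hA hC (by simp [aA]) (by simp [bA]) (by simp [cC]) vA vC
  have iBC := union B C hB hC (by simp [aC]) (by simp [bB]) (by simp [cB]) vB vC
  have dis : ∀ A B : Finset V, (A ∩ B).card ≤ 1 → Disjoint (E ∩ A.sym2) (E ∩ B.sym2) := by
    intro A B h
    have := ie_small hE h
    unfold ie at this
    rw [Finset.card_eq_zero] at this
    rw [Finset.disjoint_left]
    intro e
    induction e with
    | _ x y =>
      intro e1 e2
      have : s(x, y) ∈ E ∩ (A ∩ B).sym2 := by
        simp only [Finset.mem_inter, Finset.mk_mem_sym2_iff] at *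
        tauto
      simp_all
  have e1 : ie E A + ie E B + ie E C ≤ ie E (A ∪ B ∪ C) := by
    unfold ie
    rw [← Finset.card_union_of_disjoint (dis A B iAB), ← Finset.card_union_of_disjoint]
    · refine Finset.card_le_card ?_
      intro e
      induction e with
      | _ x y =>
        simp only [Finset.mem_union, Finset.mem_inter, Finset.mk_mem_sym2_iff]
        tauto
    · rw [Finset.disjoint_union_left]
      exact ⟨dis A C iAC, dis B C iBC⟩
  have e2 := bad (A ∪ B ∪ C) (by simp [aA]) (by simp [bA]) (by simp [cC]) (by simp [vA, vB, vC])
  have e3 := Finset.card_union_add_card_inter A B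
  have e4 := Finset.card_union_add_card_inter (A ∪ B) C
  have e5 : 1 ≤ (A ∩ B).card := Finset.card_pos.2 ⟨b, by simp [bA, bB]⟩
  have e6 : 2 ≤ ((A ∪ B) ∩ C).card :=
    Finset.one_lt_card.2 ⟨a, by simp [aA, aC], c, by simp [cB, cC], hac⟩
  omega

theorem ctr_eq {V : Type} {U : Finset V} {u0 : V} (hu0 : u0 ∈ U) {v w : V}
    (h : ctr U u0 v = ctr U u0 w) : v = w ∨ (v ∈ U ∧ w ∈ U) := by
  unfold ctr at h
  split_ifs at h with a b b
  · exact Or.inr ⟨a, b⟩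
  · exact absurd (h ▸ hu0) b
  · exact absurd (h ▸ hu0) a
  · exact Or.inl h

theorem good_contract' {V : Type} [Fintype V] {α : ℝ} (hα : 0 < α) {E : Finset (Sym2 V)}
    (hE : Lpl E) (hS : Sprs 2 E)
    (hg : ∀ E' : Finset (Sym2 V), E'.card < E.card → Lpl E' → Sprs 2 E' → Good α E')
    (hdeg : ∀ v, 1 ≤ (nb E v).card → 3 ≤ (nb E v).card)
    (hex : ∃ U : Finset V, 2 ≤ U.card ∧ 2 * U.card ≤ ie E U + 2 ∧ ¬ supp E ⊆ U) : Good α E := by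
  obtain ⟨U, hUm, hmax⟩ := Finset.exists_max_image
    (Finset.univ.filter fun U : Finset V => 2 ≤ U.card ∧ 2 * U.card ≤ ie E U + 2 ∧ ¬ supp E ⊆ U)
    Finset.card (by obtain ⟨U, hU⟩ := hex; exact ⟨U, by simpa using hU⟩)
  simp only [Finset.mem_filter, Finset.mem_univ, true_and] at hUm hmax
  obtain ⟨hU2, hUt, hUS⟩ := hUm
  have hUs := hS U hU2
  obtain ⟨u0, hu0⟩ : U.Nonempty := Finset.card_pos.1 (by omega)
  -- no outside vertex has two edges to U
  have hout : ∀ w, w ∉ U → (nb E w ∩ U).card ≤ 1 := by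
    intro w hw
    by_contra hc
    have e1 := ie_insert hE hw
    have e2 := Finset.card_insert_of_notMem hw
    have e3 := hS (insert w U) (by omega)
    have e4 : supp E ⊆ insert w U := by
      by_contra h
      have := hmax (insert w U) ⟨by omega, by omega, h⟩
      omega
    have e5 : nb E w ∩ U = nb E w := by
      rw [Finset.inter_eq_left]
      intro z hz
      have h1 := e4 (mem_supp (mem_nb.1 hz)).2
      have h2 := hE _ _ (mem_nb.1 hz)
      exact (Finset.mem_insert.1 h1).resolve_left h2.symm
    have e6 := hdeg w (by rw [← e5]; omega)
    rw [e5] at e1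
    omega
  have hmem : ∀ v w, s(v, w) ∈ U.sym2 ↔ v ∈ U ∧ w ∈ U := fun v w => by simp
  have hone : ∀ v v' w, w ∉ U → v ∈ U → v' ∈ U → s(v, w) ∈ E → s(v', w) ∈ E → v = v' := by
    intro v v' w hw hv hv' h1 h2
    refine Finset.card_le_one.1 (hout w hw) v ?_ v' ?_
    · exact Finset.mem_inter.2 ⟨mem_nb.2 (by rwa [Sym2.eq_swap]), hv⟩
    · exact Finset.mem_inter.2 ⟨mem_nb.2 (by rwa [Sym2.eq_swap]), hv'⟩
  have hinj0 : ∀ v w v' w', s(v, w) ∈ E \ U.sym2 → s(v', w') ∈ E \ U.sym2 →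
      ctr U u0 v = ctr U u0 v' → ctr U u0 w = ctr U u0 w' → s(v, w) = s(v', w') := by
    intro v w v' w' h1 h2 h3 h4
    rw [Finset.mem_sdiff, hmem] at h1 h2
    rcases ctr_eq hu0 h3 with a | a
    · rcases ctr_eq hu0 h4 with b | b
      · rw [a, b]
      · subst a
        have hv : v ∉ U := fun h => h1.2 ⟨h, b.1⟩
        rw [hone w w' v hv b.1 b.2 (by rw [Sym2.eq_swap]; exact h1.1)
          (by rw [Sym2.eq_swap]; exact h2.1)]
    · rcases ctr_eq hu0 h4 with b | b
      · subst b
        have hw : w ∉ U := fun h => h1.2 ⟨a.1, h⟩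
        rw [hone v v' w hw a.1 a.2 h1.1 h2.1]
      · exact absurd ⟨a.1, b.1⟩ h1.2
  have hinj : Set.InjOn (Sym2.map (ctr U u0)) (E \ U.sym2 : Finset (Sym2 V)) := by
    intro e he e' he' h
    induction e with
    | _ v w =>
    induction e' with
    | _ v' w' =>
      rw [Finset.mem_coe] at he he'
      simp only [Sym2.map_mk, Sym2.eq_iff] at h
      rcases h with h | h
      · exact hinj0 v w v' w' he he' h.1 h.2
      · rw [hinj0 v w w' v' he (by rwa [Sym2.eq_swap]) h.1 h.2, Sym2.eq_swap]
  have hcard : (E \ U.sym2).card + ie E U = E.card := by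
    unfold ie
    rw [Finset.card_sdiff_add_card_inter]
  refine good_contract hα U u0 hu0 hinj (hg _ ?_ ?_ ?_) (hg _ ?_ ?_ ?_)
  · refine lt_of_le_of_lt Finset.card_image_le ?_
    omega
  · intro a b h
    obtain ⟨e, he, hab⟩ := Finset.mem_image.1 h
    induction e with
    | _ v w =>
      rw [Finset.mem_sdiff, hmem] at he
      have hvw := hE v w he.1
      rintro rfl
      simp only [Sym2.map_mk, Sym2.eq_iff] at hab
      have : ctr U u0 v = ctr U u0 w := by grind
      rcases ctr_eq hu0 this with h | h
      · exact hvw h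
      · exact he.2 h
  · intro W hW
    have hle : ie ((E \ U.sym2).image (Sym2.map (ctr U u0))) W ≤
        ((E \ U.sym2).filter (fun e => Sym2.map (ctr U u0) e ∈ W.sym2)).card := by
      unfold ie
      refine le_trans (Finset.card_le_card ?_) (Finset.card_image_le (f := Sym2.map (ctr U u0)))
      intro e he
      rw [Finset.mem_inter] at he
      obtain ⟨e', he', rfl⟩ := Finset.mem_image.1 he.1
      exact Finset.mem_image.2 ⟨e', Finset.mem_filter.2 ⟨he', he.2⟩, rfl⟩
    by_cases hu : u0 ∈ W
    · have h1 : ((E \ U.sym2).filter (fun e => Sym2.map (ctr U u0) e ∈ W.sym2)).card + ie E U ≤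
          ie E (W ∪ U) := by
        unfold ie
        rw [← Finset.card_union_of_disjoint]
        · refine Finset.card_le_card ?_
          intro e
          induction e with
          | _ a b =>
            simp only [Finset.mem_union, Finset.mem_filter, Finset.mem_sdiff, Sym2.map_mk,
              Finset.mk_mem_sym2_iff, Finset.mem_inter, ctr]
            grind
        · rw [Finset.disjoint_left]
          intro e h1 h2
          exact (Finset.mem_sdiff.1 (Finset.mem_filter.1 h1).1).2 (Finset.mem_inter.1 h2).2
      have h2 := Finset.card_union_add_card_inter W U
      have h3 : 1 ≤ (W ∩ U).card := Finset.card_pos.2 ⟨u0, by simp [hu, hu0]⟩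
      have h4 := Finset.card_le_card (Finset.subset_union_right (s₁ := W) (s₂ := U))
      have h5 := hS (W ∪ U) (by omega)
      omega
    · have h1 : ((E \ U.sym2).filter (fun e => Sym2.map (ctr U u0) e ∈ W.sym2)).card ≤
          ie E W := by
        unfold ie
        refine Finset.card_le_card ?_
        intro e
        induction e with
        | _ a b =>
          simp only [Finset.mem_filter, Finset.mem_sdiff, Sym2.map_mk,
            Finset.mk_mem_sym2_iff, Finset.mem_inter, ctr]
          grind
      have := hS W hW
      omega
  · have : ∃ v ∈ supp E, v ∉ U := by
      by_contra h
      push Not at h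
      exact hUS h
    obtain ⟨v, hv, hvU⟩ := this
    simp only [supp, Finset.mem_filter, Finset.mem_univ, true_and] at hv
    obtain ⟨w, hw⟩ := hv
    refine Finset.card_lt_card (Finset.ssubset_iff_subset_ne.2 ⟨Finset.inter_subset_left, ?_⟩)
    intro h
    have h1 := mem_nb.1 hw
    rw [← h, Finset.mem_inter, hmem] at h1
    exact hvU h1.2.1
  · exact lpl_mono Finset.inter_subset_left hE
  · exact sprs_mono Finset.inter_subset_left hS

theorem good_two {V : Type} [Fintype V] {α : ℝ} (hα : 0 < α) (hα1 : α ≠ 1) :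
    ∀ (n : ℕ) (E : Finset (Sym2 V)), E.card = n → Lpl E → Sprs 2 E → Good α E := by
  intro n
  induction n using Nat.strong_induction_on with
  | _ n ih =>
  intro E hn hE hS
  have hg : ∀ E' : Finset (Sym2 V), E'.card < E.card → Lpl E' → Sprs 2 E' → Good α E' :=
    fun E' h1 h2 h3 => ih _ (hn ▸ h1) E' rfl h2 h3
  rcases E.eq_empty_or_nonempty with rfl | hne
  · exact good_empty α
  by_cases hlow : ∃ v, 1 ≤ (nb E v).card ∧ (nb E v).card ≤ 2
  · obtain ⟨v, h1, h2⟩ := hlow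
    refine step_low hα hE v h1 h2 (hg _ ?_ (lpl_mono (Finset.filter_subset _ _) hE)
      (sprs_mono (Finset.filter_subset _ _) hS))
    have := card_del (E := E) v
    omega
  push Not at hlow
  have hdeg : ∀ v, 1 ≤ (nb E v).card → 3 ≤ (nb E v).card := fun v h => hlow v h
  obtain ⟨v, h1, h3⟩ := exists_low hE (by norm_num) hS hne
  have h2 : (nb E v).card = 3 := le_antisymm h3 (hdeg v h1)
  obtain ⟨a, b, c, hab, hac, hbc, hnb⟩ := Finset.card_eq_three.1 h2
  have hlp : ∀ w, w ∈ nb E v → w ≠ v := fun w hw => (hE v w (mem_nb.1 hw)).symm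
  have hav := hlp a (by simp [hnb])
  have hbv := hlp b (by simp [hnb])
  have hcv := hlp c (by simp [hnb])
  have hvs : v ∈ supp E := (mem_supp (mem_nb.1 (show a ∈ nb E v by simp [hnb]))).1
  by_contra hcon
  have hnoU : ∀ U : Finset V, 2 ≤ U.card → 2 * U.card ≤ ie E U + 2 → supp E ⊆ U := by
    intro U h4 h5
    by_contra h6
    exact hcon (good_contract' hα hE hS hg hdeg ⟨U, h4, h5, h6⟩)
  have key : ∀ a b c : V, a ≠ b → a ≠ c → b ≠ c → nb E v = {a, b, c} → s(a, b) ∈ E := by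
    intro a b c hab hac hbc hnb
    rcases step_three hα hE hS hg v a b c hab hac hbc hnb with h | h | ⟨U, aU, bU, vU, hU⟩
    · exact absurd h hcon
    · exact h
    · exact absurd (hnoU U (Finset.one_lt_card.2 ⟨a, aU, b, bU, hab⟩) hU hvs) vU
  have eab := key a b c hab hac hbc hnb
  have ebc := key b c a hbc hab.symm hac.symm (by rw [hnb]; grind)
  have eac := key a c b hac hab hbc.symm (by rw [hnb]; grind)
  have vK : v ∉ ({a, b, c} : Finset V) := by simp [hav.symm, hbv.symm, hcv.symm]
  have cK : ({a, b, c} : Finset V).card = 3 := Finset.card_eq_three.2 ⟨a, b, c, hab, hac, hbc, rfl⟩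
  have i1 := ie_insert hE vK
  rw [hnb, Finset.inter_self, cK] at i1
  have i2 : 3 ≤ ie E {a, b, c} := by
    have : ({s(a, b), s(b, c), s(a, c)} : Finset (Sym2 V)).card = 3 :=
      Finset.card_eq_three.2 ⟨_, _, _, by simp; grind, by simp; grind, by simp; grind, rfl⟩
    rw [← this]
    refine Finset.card_le_card ?_
    intro e he
    simp only [Finset.mem_insert, Finset.mem_singleton] at he
    rcases he with rfl | rfl | rfl
    · simp [eab]
    · simp [ebc]
    · simp [eac]
  have cK' := Finset.card_insert_of_notMem vK
  have hsub := hnoU _ (by omega) (by omega : 2 * (insert v ({a, b, c} : Finset V)).card ≤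
    ie E (insert v {a, b, c}) + 2)
  apply hcon
  refine good_K4 hα hα1 v a b c hav.symm hbv.symm hcv.symm hab hac hbc ?_
  intro u w h
  have := hsub (mem_supp h).2
  simpa using this

theorem rc_symm (q a b : ℝ) : rigidityCoef q b a = - rigidityCoef q a b := by
  unfold rigidityCoef
  rw [← neg_sub a b, Real.sign_neg, abs_neg]
  ring

theorem rc_self (q a : ℝ) : rigidityCoef q a a = 0 := by
  simp [rigidityCoef]

theorem rc_ne (q : ℝ) {a b : ℝ} (h : a ≠ b) : rigidityCoef q a b ≠ 0 := by
  unfold rigidityCoef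
  have h' : a - b ≠ 0 := sub_ne_zero.2 h
  refine mul_ne_zero ?_ ?_
  · rwa [Ne, Real.sign_eq_zero_iff]
  · have : 0 < |a - b| := abs_pos.2 h'
    positivity

theorem rc_two (a b : ℝ) : rigidityCoef 2 a b = a - b := by
  unfold rigidityCoef
  norm_num
  rcases lt_trichotomy (a - b) 0 with h | h | h
  · rw [Real.sign_of_neg h, abs_of_neg h]; ring
  · rw [h]; simp
  · rw [Real.sign_of_pos h, abs_of_pos h]; ring

theorem row_symm {V : Type} (q : ℝ) {d : ℕ} (p : V → Fin d → ℝ) (v w : V) :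
    rigidityRow q p w v = rigidityRow q p v w := by
  funext x
  unfold rigidityRow
  rw [rc_symm q (p v x.2)]
  split_ifs <;> ring

/-- The row of an unoriented edge. -/
def rowS {V : Type} (q : ℝ) {d : ℕ} (p : V → Fin d → ℝ) (e : Sym2 V) : V × Fin d → ℝ :=
  rigidityRow q p (Quot.out e).1 (Quot.out e).2

theorem rowS_mk {V : Type} (q : ℝ) {d : ℕ} (p : V → Fin d → ℝ) (v w : V) :
    rowS q p s(v, w) = rigidityRow q p v w := by
  have h : s((Quot.out s(v, w)).1, (Quot.out s(v, w)).2) = s(v, w) := Quot.out_eq _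
  unfold rowS
  rcases Sym2.eq_iff.1 h with h | h
  · rw [h.1, h.2]
  · rw [h.1, h.2, row_symm]

theorem rowS_apply {V : Type} [Fintype V] (q : ℝ) {d : ℕ} (p : V → Fin d → ℝ) (e : Sym2 V) (v : V)
    (i : Fin d) : rowS q p e (v, i) =
      ∑ w, if e = s(v, w) then rigidityCoef q (p v i) (p w i) else 0 := by
  induction e with
  | _ a b =>
  rw [rowS_mk]
  simp only [rigidityRow]
  by_cases ha : v = a
  · subst ha
    rw [Fintype.sum_eq_single b]
    · simp only [if_true]
      split_ifs with h
      · rw [h, rc_self]; simp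
      · simp
    · intro w hw
      rw [if_neg]
      rw [Sym2.eq_iff]
      grind
  · by_cases hb : v = b
    · subst hb
      rw [Fintype.sum_eq_single a]
      · rw [if_neg ha, if_pos rfl, if_pos Sym2.eq_swap, rc_symm q (p v i)]; simp
      · intro w hw
        rw [if_neg]
        rw [Sym2.eq_iff]
        grind
    · rw [if_neg ha, if_neg hb, sub_zero, Finset.sum_eq_zero]
      intro w _
      rw [if_neg]
      rw [Sym2.eq_iff]
      grind

theorem comb_apply {V : Type} [Fintype V] (q : ℝ) {d : ℕ} (p : V → Fin d → ℝ)
    (E : Finset (Sym2 V)) (ω : Sym2 V → ℝ) (v : V) (i : Fin d) :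
    (∑ e ∈ E, ω e • rowS q p e) (v, i) =
      ∑ w, if s(v, w) ∈ E then ω s(v, w) * rigidityCoef q (p v i) (p w i) else 0 := by
  rw [Finset.sum_apply]
  simp only [Pi.smul_apply, smul_eq_mul, rowS_apply, Finset.mul_sum]
  rw [Finset.sum_comm]
  refine Finset.sum_congr rfl fun w _ => ?_
  simp only [mul_ite, mul_zero]
  rw [Finset.sum_ite_eq']

theorem indep_of_indW {V : Type} [Fintype V] {q : ℝ} {E : Finset (Sym2 V)}
    (hE : Lpl E) {x y : V → ℝ} (hxy : CoM x y) (hI : IndW E (slo (q - 1) x y)) :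
    LinearIndepOn ℝ (rowS q (fun v => ![x v, y v])) (E : Set (Sym2 V)) := by
  rw [linearIndepOn_finset_iff]
  intro ω hω
  have hk : ∀ v w, rigidityCoef q (y v) (y w) =
      slo (q - 1) x y v w * rigidityCoef q (x v) (x w) := by
    intro v w
    by_cases hvw : v = w
    · subst hvw; simp [rc_self]
    · have h1 := hxy.slope_pos hvw
      have h2 : x v - x w ≠ 0 := sub_ne_zero.2 (hxy.ne hvw)
      unfold slo rigidityCoef
      set σ := (y v - y w) / (x v - x w) with hσ
      have h3 : y v - y w = σ * (x v - x w) := by rw [hσ]; field_simp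
      rw [h3, abs_mul, abs_of_pos h1, Real.mul_rpow h1.le (abs_nonneg _)]
      have : Real.sign (σ * (x v - x w)) = Real.sign (x v - x w) := by
        rcases lt_or_gt_of_ne h2 with h | h
        · rw [Real.sign_of_neg h, Real.sign_of_neg (mul_neg_of_pos_of_neg h1 h)]
        · rw [Real.sign_of_pos h, Real.sign_of_pos (mul_pos h1 h)]
      rw [this]; ring
  have hnode : ∀ v (i : Fin 2), ∑ w, (if s(v, w) ∈ E then ω s(v, w) * rigidityCoef q
      ((fun v => ![x v, y v]) v i) ((fun v => ![x v, y v]) w i) else 0) = 0 := by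
    intro v i
    have := comb_apply q (fun v => ![x v, y v]) E ω v i
    rw [hω] at this
    exact this.symm
  have h0 := hI (fun v w => if s(v, w) ∈ E then ω s(v, w) * rigidityCoef q (x v) (x w) else 0)
    ?_ ?_ ?_ ?_
  · intro e he
    induction e with
    | _ v w =>
      have := h0 v w
      rw [if_pos he] at this
      exact (mul_eq_zero.1 this).resolve_right (rc_ne q (hxy.ne (hE v w he)))
  · intro v w
    simp only [Sym2.eq_swap (a := w)]
    split_ifs
    · rw [rc_symm q (x v)]; ring
    · ring
  · intro v w h
    rw [if_neg h]
  · intro v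
    simpa using hnode v 0
  · intro v
    have := hnode v 1
    simp only [Matrix.cons_val_one, Matrix.cons_val_fin_one] at this
    refine Eq.trans (Finset.sum_congr rfl fun w _ => ?_) this
    rw [hk]
    split_ifs <;> ring

theorem nec_count {V : Type} [Fintype V] {q : ℝ} {E : Finset (Sym2 V)} {p : V → Fin 2 → ℝ}
    (hI : LinearIndepOn ℝ (rowS q p) (E : Set (Sym2 V))) (U : Finset V) (l : ℕ)
    (Ψ : (U × Fin 2 → ℝ) →ₗ[ℝ] (Fin l → ℝ)) (hs : Function.Surjective Ψ)
    (h0 : ∀ v w, v ∈ U → w ∈ U → s(v, w) ∈ E →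
      Ψ (fun x => rigidityRow q p v w (x.1.1, x.2)) = 0) : ie E U + l ≤ 2 * U.card := by
  let R : Sym2 V → (U × Fin 2 → ℝ) := fun e x => rowS q p e (x.1.1, x.2)
  have hR : LinearIndepOn ℝ R ((E ∩ U.sym2 : Finset (Sym2 V)) : Set (Sym2 V)) := by
    have hI' := hI.mono (t := ((E ∩ U.sym2 : Finset (Sym2 V)) : Set (Sym2 V)))
      (by exact_mod_cast Finset.inter_subset_left)
    rw [linearIndepOn_finset_iff] at hI' ⊢
    intro ω hω
    apply hI' ω
    funext x
    by_cases hx : x.1 ∈ U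
    · have := congrFun hω (⟨x.1, hx⟩, x.2)
      simpa [Finset.sum_apply, R] using this
    · rw [Finset.sum_apply]
      refine Finset.sum_eq_zero fun e he => ?_
      induction e with
      | _ a b =>
        simp only [Finset.mem_inter, Finset.mk_mem_sym2_iff] at he
        have e1 : x.1 ≠ a := fun h => hx (h ▸ he.2.1)
        have e2 : x.1 ≠ b := fun h => hx (h ▸ he.2.2)
        rw [Pi.smul_apply, rowS_mk]
        simp [rigidityRow, e1, e2]
  have h1 := finrank_span_eq_card hR
  have h2 : Submodule.span ℝ (Set.range fun e : ((E ∩ U.sym2 : Finset (Sym2 V)) : Set (Sym2 V)) =>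
      R e) ≤ LinearMap.ker Ψ := by
    rw [Submodule.span_le]
    rintro _ ⟨⟨e, he⟩, rfl⟩
    induction e with
    | _ a b =>
      rw [Finset.mem_coe, Finset.mem_inter, Finset.mk_mem_sym2_iff] at he
      have := h0 a b he.2.1 he.2.2 he.1
      simpa [R, rowS_mk] using this
  have h3 := Submodule.finrank_mono h2
  have h4 := LinearMap.finrank_range_add_finrank_ker Ψ
  rw [LinearMap.range_eq_top.2 hs, finrank_top] at h4
  simp only [Module.finrank_fintype_fun_eq_card, Fintype.card_fin, Fintype.card_prod,
    Fintype.card_coe] at h4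
  have h5 : Fintype.card ((E ∩ U.sym2 : Finset (Sym2 V)) : Set (Sym2 V)) = ie E U := by
    unfold ie
    exact Fintype.card_coe _
  rw [h5] at h1
  omega

theorem nec_two {V : Type} [Fintype V] {q : ℝ} {E : Finset (Sym2 V)} {p : V → Fin 2 → ℝ}
    (hI : LinearIndepOn ℝ (rowS q p) (E : Set (Sym2 V))) : Sprs 2 E := by
  intro U hU
  let Ψ : (U × Fin 2 → ℝ) →ₗ[ℝ] (Fin 2 → ℝ) :=
    { toFun := fun g i => ∑ u : U, g (u, i)
      map_add' := fun g h => by funext i; simp [Finset.sum_add_distrib]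
      map_smul' := fun c g => by funext i; simp [Finset.mul_sum] }
  obtain ⟨u0, hu0⟩ : U.Nonempty := Finset.card_pos.1 (by omega)
  refine nec_count hI U 2 Ψ ?_ ?_
  · intro z
    refine ⟨fun x => if x.1 = ⟨u0, hu0⟩ then z x.2 else 0, ?_⟩
    funext i
    change ∑ u : U, (if u = ⟨u0, hu0⟩ then z i else 0) = z i
    simp
  · intro v w hv hw _
    funext i
    change ∑ u : U, rigidityRow q p v w (u.1, i) = 0
    rw [Finset.sum_coe_sort U (fun u => rigidityRow q p v w (u, i))]
    simp [rigidityRow, Finset.sum_sub_distrib, hv, hw]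

theorem nec_three {V : Type} [Fintype V] {E : Finset (Sym2 V)} {p : V → Fin 2 → ℝ}
    (hp : ∀ v w, s(v, w) ∈ E → p v ≠ p w)
    (hI : LinearIndepOn ℝ (rowS 2 p) (E : Set (Sym2 V))) : Sprs 3 E := by
  intro U hU
  by_cases hem : ie E U = 0
  · omega
  obtain ⟨e, he⟩ := Finset.card_pos.1 (Nat.pos_of_ne_zero hem)
  induction e with
  | _ a b =>
  rw [Finset.mem_inter, Finset.mk_mem_sym2_iff] at he
  have hab := hp a b he.1
  have hab' : a ≠ b := fun h => hab (h ▸ rfl)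
  let Ψ : (U × Fin 2 → ℝ) →ₗ[ℝ] (Fin 3 → ℝ) :=
    { toFun := fun g => ![∑ u : U, g (u, 0), ∑ u : U, g (u, 1),
        ∑ u : U, (p u.1 1 * g (u, 0) - p u.1 0 * g (u, 1))]
      map_add' := fun g h => by
        funext i
        fin_cases i
        · simp [Finset.sum_add_distrib]
        · simp [Finset.sum_add_distrib]
        · simp [Finset.sum_add_distrib, mul_add]
          ring
      map_smul' := fun c g => by
        funext i
        fin_cases i
        · simp [Finset.mul_sum]
        · simp [Finset.mul_sum]
        · simp
          rw [mul_sub, Finset.mul_sum, Finset.mul_sum]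
          congr 1 <;> exact Finset.sum_congr rfl fun u _ => by ring }
  refine nec_count hI U 3 Ψ ?_ ?_
  · intro z
    set d0 := p a 0 - p b 0 with hd0
    set d1 := p a 1 - p b 1 with hd1
    have hD : d0 ^ 2 + d1 ^ 2 ≠ 0 := by
      intro h
      have h0 : d0 = 0 := by nlinarith [sq_nonneg d0, sq_nonneg d1]
      have h1 : d1 = 0 := by nlinarith [sq_nonneg d0, sq_nonneg d1]
      apply hab
      funext i
      fin_cases i
      · exact sub_eq_zero.1 h0
      · exact sub_eq_zero.1 h1
    set κ := (z 2 - p a 1 * z 0 + p a 0 * z 1) / (d0 ^ 2 + d1 ^ 2) with hκ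
    have hκ' : κ * (d0 ^ 2 + d1 ^ 2) = z 2 - p a 1 * z 0 + p a 0 * z 1 := by
      rw [hκ]; field_simp
    let A : Fin 2 → ℝ := ![z 0 + κ * d1, z 1 - κ * d0]
    let B : Fin 2 → ℝ := ![- κ * d1, κ * d0]
    have hne : (⟨a, he.2.1⟩ : U) ≠ ⟨b, he.2.2⟩ := by simpa using hab'
    have hs : ∀ k : U → ℝ, (∀ u, u ≠ ⟨a, he.2.1⟩ → u ≠ ⟨b, he.2.2⟩ → k u = 0) →
      ∑ u : U, k u = k ⟨a, he.2.1⟩ + k ⟨b, he.2.2⟩ := fun k hk => sum_two k hne hk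
    let g : U × Fin 2 → ℝ := fun x => if x.1 = ⟨a, he.2.1⟩ then A x.2 else
      if x.1 = ⟨b, he.2.2⟩ then B x.2 else 0
    have ga : ∀ i, g (⟨a, he.2.1⟩, i) = A i := fun i => by simp [g]
    have gb : ∀ i, g (⟨b, he.2.2⟩, i) = B i := fun i => by simp [g, hab'.symm]
    have g0 : ∀ u i, u ≠ ⟨a, he.2.1⟩ → u ≠ ⟨b, he.2.2⟩ → g (u, i) = 0 := fun u i h1 h2 => by
      simp [g, h1, h2]
    refine ⟨g, ?_⟩
    change ![∑ u : U, g (u, 0), ∑ u : U, g (u, 1),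
        ∑ u : U, (p u.1 1 * g (u, 0) - p u.1 0 * g (u, 1))] = z
    rw [hs _ (fun u h1 h2 => g0 u 0 h1 h2), hs _ (fun u h1 h2 => g0 u 1 h1 h2),
      hs _ (fun u h1 h2 => by rw [g0 u 0 h1 h2, g0 u 1 h1 h2]; ring)]
    rw [ga, ga, gb, gb]
    funext i
    fin_cases i
    · simp [A, B]
    · simp [A, B]
    · simp [A, B]
      rw [hd0, hd1] at *
      linear_combination hκ'
  · intro v w hv hw _
    have hs : ∀ k : V → ℝ, ∀ i, ∑ u : U, k u.1 * rigidityRow 2 p v w (u.1, i) =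
        (k v - k w) * (p v i - p w i) := by
      intro k i
      rw [Finset.sum_coe_sort U (fun u => k u * rigidityRow 2 p v w (u, i))]
      simp only [rigidityRow, mul_sub, mul_ite, mul_zero, Finset.sum_sub_distrib,
        Finset.sum_ite_eq', if_pos hv, if_pos hw, rc_two]
      ring
    change ![∑ u : U, rigidityRow 2 p v w (u.1, 0), ∑ u : U, rigidityRow 2 p v w (u.1, 1),
        ∑ u : U, (p u.1 1 * rigidityRow 2 p v w (u.1, 0) -
          p u.1 0 * rigidityRow 2 p v w (u.1, 1))] = 0
    rw [Finset.sum_sub_distrib, hs (fun u => p u 1), hs (fun u => p u 0)]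
    have h0 := hs (fun _ => 1) 0
    have h1 := hs (fun _ => 1) 1
    simp only [one_mul] at h0 h1
    rw [h0, h1]
    funext i
    fin_cases i
    · simp
    · simp
    · simp; ring

theorem rowset_eq {V : Type} (q : ℝ) {d : ℕ} (G : SimpleGraph V) (p : V → Fin d → ℝ) :
    {r : V × Fin d → ℝ | ∃ v w, G.Adj v w ∧ r = rigidityRow q p v w} =
      rowS q p '' G.edgeSet := by
  ext r
  constructor
  · rintro ⟨v, w, h, rfl⟩
    exact ⟨s(v, w), h, rowS_mk q p v w⟩
  · rintro ⟨e, he, rfl⟩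
    induction e with
    | _ v w => exact ⟨v, w, he, rowS_mk q p v w⟩

theorem rank_eq {V : Type} (q : ℝ) {d : ℕ} (G : SimpleGraph V) (p : V → Fin d → ℝ) :
    rigidityRank q G p = Module.finrank ℝ (Submodule.span ℝ (rowS q p '' G.edgeSet)) := by
  unfold rigidityRank
  rw [rowset_eq]

/-- Extension by zero. -/
def extZ {V : Type} (W : Set V) (d : ℕ) : (W × Fin d → ℝ) →ₗ[ℝ] (V × Fin d → ℝ) where
  toFun g x := if h : x.1 ∈ W then g (⟨x.1, h⟩, x.2) else 0
  map_add' g k := by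
    funext x
    by_cases h : x.1 ∈ W <;> simp [h]
  map_smul' c g := by
    funext x
    by_cases h : x.1 ∈ W <;> simp [h]

theorem extZ_inj {V : Type} (W : Set V) (d : ℕ) : Function.Injective (extZ W d) := by
  intro g k h
  funext ⟨⟨v, hv⟩, i⟩
  have := congrFun h (v, i)
  simpa [extZ, hv] using this

theorem extZ_row {V : Type} (W : Set V) (d : ℕ) (q : ℝ) (x : V → Fin d → ℝ) (v w : W) :
    extZ W d (rigidityRow q (fun u : W => x u.1) v w) = rigidityRow q x v.1 w.1 := by
  funext y
  obtain ⟨v, hv⟩ := v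
  obtain ⟨w, hw⟩ := w
  by_cases h : y.1 ∈ W
  · simp [extZ, rigidityRow, h]
  · have h1 : y.1 ≠ v := fun e => h (e ▸ hv)
    have h2 : y.1 ≠ w := fun e => h (e ▸ hw)
    simp [extZ, rigidityRow, h, h1, h2]

/-- Pushing a graph on a subset forward. -/
def pushG {V : Type} (W : Set V) (H : SimpleGraph W) : SimpleGraph V :=
  H.map (Function.Embedding.subtype (· ∈ W))

theorem pushG_adj {V : Type} (W : Set V) (H : SimpleGraph W) (a b : V) :
    (pushG W H).Adj a b ↔ ∃ u v : W, H.Adj u v ∧ u.1 = a ∧ v.1 = b := by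
  unfold pushG
  rw [SimpleGraph.map_adj]
  rfl

theorem rank_push {V : Type} (W : Set V) (d : ℕ) (q : ℝ) (H : SimpleGraph W)
    (x : V → Fin d → ℝ) :
    rigidityRank q H (fun u : W => x u.1) = rigidityRank q (pushG W H) x := by
  unfold rigidityRank
  have : {r : V × Fin d → ℝ | ∃ v w, (pushG W H).Adj v w ∧ r = rigidityRow q x v w} =
      extZ W d '' {r : W × Fin d → ℝ | ∃ v w, H.Adj v w ∧
        r = rigidityRow q (fun u : W => x u.1) v w} := by
    ext r
    constructor
    · rintro ⟨a, b, h, rfl⟩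
      obtain ⟨u, v, h', rfl, rfl⟩ := (pushG_adj W H a b).1 h
      exact ⟨_, ⟨u, v, h', rfl⟩, extZ_row W d q x u v⟩
    · rintro ⟨_, ⟨u, v, h, rfl⟩, rfl⟩
      exact ⟨u.1, v.1, (pushG_adj W H _ _).2 ⟨u, v, h, rfl, rfl⟩, extZ_row W d q x u v⟩
  rw [this, ← Submodule.map_span]
  exact LinearEquiv.finrank_eq (Submodule.equivMapOfInjective (extZ W d) (extZ_inj W d) _)

theorem rank_indep {V : Type} [Fintype V] (q : ℝ) (p : V → Fin 2 → ℝ) {b : Set (Sym2 V)} [Fintype b]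
    (h : LinearIndepOn ℝ (rowS q p) b) :
    Module.finrank ℝ (Submodule.span ℝ (rowS q p '' b)) = Fintype.card b := by
  rw [Set.image_eq_range]
  exact finrank_span_eq_card h

theorem edge_lpl {V : Type} [Fintype V] (G : SimpleGraph V) {b : Set (Sym2 V)} [Fintype b]
    (hb : b ⊆ G.edgeSet) : Lpl b.toFinset := by
  intro v w h
  have : G.Adj v w := hb (Set.mem_toFinset.1 h)
  exact this.ne

/-- The necessity property. -/
def Nec (q : ℝ) (l : ℕ) (V : Type) [Fintype V] : Prop :=
  ∀ (E : Finset (Sym2 V)) (p : V → Fin 2 → ℝ), (∀ v w, s(v, w) ∈ E → p v ≠ p w) →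
    LinearIndepOn ℝ (rowS q p) (E : Set (Sym2 V)) → Sprs l E

theorem rank_max {V : Type} [Fintype V] {q : ℝ} {l : ℕ} (hN : Nec q l V) {x y : V → ℝ}
    (hxy : CoM x y) (hI : ∀ E : Finset (Sym2 V), Lpl E ∧ Sprs l E → IndW E (slo (q - 1) x y))
    (G : SimpleGraph V) (z : V → Fin 2 → ℝ) (hz : IsPlacement G z) :
    rigidityRank q G z ≤ rigidityRank q G (fun v => ![x v, y v]) := by
  obtain ⟨b, hb, -, hsp, hli⟩ := exists_linearIndepOn_extension
    (linearIndepOn_empty ℝ (rowS q z)) (Set.empty_subset G.edgeSet)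
  have hL := edge_lpl G hb
  have hS : Sprs l b.toFinset := by
    refine hN _ z ?_ (by rwa [Set.coe_toFinset])
    intro v w h
    exact hz (hb (Set.mem_toFinset.1 h))
  have h1 := indep_of_indW hL hxy (hI _ ⟨hL, hS⟩)
  rw [Set.coe_toFinset] at h1
  rw [rank_eq, rank_eq]
  calc _ ≤ Module.finrank ℝ (Submodule.span ℝ (rowS q z '' b)) :=
        Submodule.finrank_mono (Submodule.span_le.2 hsp)
    _ = Module.finrank ℝ (Submodule.span ℝ (rowS q (fun v => ![x v, y v]) '' b)) := by
        rw [rank_indep q z hli, rank_indep q _ h1]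
    _ ≤ _ := Submodule.finrank_mono (Submodule.span_mono (Set.image_mono hb))

theorem generic_star {V : Type} [Fintype V] {q : ℝ} {l : ℕ} (hN : Nec q l V) {x y : V → ℝ}
    (hxy : CoM x y) (hI : ∀ E : Finset (Sym2 V), Lpl E ∧ Sprs l E → IndW E (slo (q - 1) x y)) :
    IsGeneric q (fun v => ![x v, y v]) := by
  have hinj : Function.Injective (fun v => ![x v, y v]) := by
    intro v w h
    by_contra hne
    exact hxy.ne hne (by simpa using congrFun h 0)
  intro W _
  refine ⟨hinj.injOn, fun W' _ H => ⟨?_, ?_⟩⟩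
  · intro v w h e
    exact h.ne (Subtype.ext (hinj e))
  · intro z hz
    let z' : V → Fin 2 → ℝ := fun v => if h : v ∈ W' then z ⟨v, h⟩ else 0
    have hz' : (fun u : W' => z' u.1) = z := by
      funext u
      simp [z']
    have hpl : IsPlacement (pushG W' H) z' := by
      intro a b h
      obtain ⟨u, v, h', rfl, rfl⟩ := (pushG_adj W' H a b).1 h
      have := hz h'
      rw [← hz'] at this
      exact this
    have := rank_max hN hxy hI (pushG W' H) z' hpl
    rw [← rank_push, ← rank_push, hz'] at this
    exact this

theorem graphSparse_iff {V : Type} [Fintype V] (G : SimpleGraph V) (l : ℕ) :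
    GraphSparse 2 l G ↔ Sprs l G.edgeSet.toFinset := by
  constructor
  · intro h U hU
    have := h ((⊤ : G.Subgraph).induce (U : Set V)) (by simpa using hU)
    have he : ((⊤ : G.Subgraph).induce (U : Set V)).edgeSet =
        ((G.edgeSet.toFinset ∩ U.sym2 : Finset (Sym2 V)) : Set (Sym2 V)) := by
      ext e
      induction e with
      | _ a b =>
        simp
        tauto
    rw [he, Set.ncard_coe_finset] at this
    simp only [SimpleGraph.Subgraph.induce_verts, Set.ncard_coe_finset] at this
    unfold ie
    push_cast at this
    omega
  · intro h H hH
    have hv : H.verts.ncard = H.verts.toFinset.card := Set.ncard_eq_toFinset_card' _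
    have := h H.verts.toFinset (by omega)
    have he : H.edgeSet.ncard ≤ ie G.edgeSet.toFinset H.verts.toFinset := by
      unfold ie
      rw [← Set.ncard_coe_finset]
      refine Set.ncard_le_ncard ?_ (Finset.finite_toSet _)
      intro e he
      induction e with
      | _ a b =>
        have hab : H.Adj a b := he
        simp [hab.adj_sub, hab.fst_mem, hab.snd_mem]
    push_cast
    omega

theorem main_aux {V : Type} [Fintype V] (G : SimpleGraph V) {q : ℝ} {l : ℕ} (hN : Nec q l V)
    (hG : ∀ E : Finset (Sym2 V), Lpl E ∧ Sprs l E → Good (q - 1) E) :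
    (∀ p : V → Fin 2 → ℝ, IsGeneric q p → LinearIndependent ℝ (fun e : G.edgeSet =>
      rigidityRow q p (Quot.out (e : Sym2 V)).1 (Quot.out (e : Sym2 V)).2)) ↔
      GraphSparse 2 l G := by
  obtain ⟨x, y, hxy, hI⟩ := common (q - 1) (fun E : Finset (Sym2 V) => Lpl E ∧ Sprs l E) hG
  have hgen := generic_star hN hxy hI
  rw [graphSparse_iff]
  constructor
  · intro h
    have h1 : LinearIndepOn ℝ (rowS q (fun v => ![x v, y v])) G.edgeSet := h _ hgen
    refine hN _ (fun v => ![x v, y v]) ?_ (by rwa [Set.coe_toFinset])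
    intro v w hvw e
    have hne := edge_lpl G (le_refl G.edgeSet) v w hvw
    exact hxy.ne hne (by simpa using congrFun e 0)
  · intro hS p hp
    have hL := edge_lpl G (le_refl G.edgeSet)
    have h1 := indep_of_indW hL hxy (hI _ ⟨hL, hS⟩)
    rw [Set.coe_toFinset] at h1
    have hr := rank_indep q _ h1
    rw [← rank_eq] at hr
    have hreg := (hp Set.univ Set.finite_univ).2 Set.univ le_rfl (G.comap Subtype.val)
    have hpush : pushG Set.univ (G.comap Subtype.val) = G := by
      ext a b
      rw [pushG_adj]
      constructor
      · rintro ⟨u, v, h, rfl, rfl⟩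
        exact h
      · intro h
        exact ⟨⟨a, trivial⟩, ⟨b, trivial⟩, h, rfl, rfl⟩
    have h2 := hreg.2 (fun u => ![x u.1, y u.1]) (by
      intro a b h e
      have hne : a.1 ≠ b.1 := fun e => h.ne (Subtype.ext e)
      exact hxy.ne hne (by simpa using congrFun e 0))
    rw [rank_push Set.univ 2 q (G.comap Subtype.val) p,
      rank_push Set.univ 2 q (G.comap Subtype.val) (fun v => ![x v, y v]), hpush, hr, rank_eq,
      Set.image_eq_range] at h2
    exact linearIndependent_iff_card_le_finrank_span.2 h2

theorem statement_14 {V : Type} [Fintype V] (G : SimpleGraph V) {q : ℝ} (hq : 1 < q)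
    (l : ℕ)
    (hcase : (q = 2 ∧ l = 3 ∧ 2 ≤ Fintype.card V) ∨ (q ≠ 2 ∧ l = 2 ∧ 4 ≤ Fintype.card V)) :
    (∀ p : V → Fin 2 → ℝ, IsGeneric q p →
        LinearIndependent ℝ
          (fun e : G.edgeSet => rigidityRow q p (Quot.out (e : Sym2 V)).1
            (Quot.out (e : Sym2 V)).2)) ↔
      GraphSparse 2 l G := by
  rcases hcase with ⟨rfl, rfl, -⟩ | ⟨h2, rfl, -⟩
  · exact main_aux G (fun E p hp hI => nec_three hp hI)
      (fun E hE => good_laman (by norm_num) _ E rfl hE.1 hE.2)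
  · exact main_aux G (fun E p _ hI => nec_two hI)
      (fun E hE => good_two (by linarith) (fun h => h2 (by linarith)) _ E rfl hE.1 hE.2)

end RigidityPaper
end
end

section
/- Let {(G_k,p_k) : k ∈ ℕ} be a tower of bar-joint frameworks in a finite-dimensional real normed space (X,‖·‖), and let u₁ be an infinitesimal flex of (G₁,p₁) which is enduring for the tower, i.e. for every k there exists an infinitesimal flex of (G_k,p_k) whose restriction to V(G₁) is u₁. Then there exists a sequence (u_k)_{k∈ℕ} such that for each k, u_k is an infinitesimal flex of (G_k,p_k), u_{k+1} restricted to V(G_k) equals u_k, and u₁ is the given flex. -/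
open Asymptotics Filter Topology Set

open scoped Classical

noncomputable section

namespace RigidityPaper

variable {V X E : Type}

variable {G : SimpleGraph V}

def smoothDir {X : Type} [NormedAddCommGroup X] [NormedSpace ℝ X] (x z : X) : Prop :=
  (fun t : ℝ => ‖x + t • z‖ - ‖x‖) =o[𝓝 (0 : ℝ)] (fun t : ℝ => t)

theorem smoothDir_smul {X : Type} [NormedAddCommGroup X] [NormedSpace ℝ X] {x z : X}
    (c : ℝ) (h : smoothDir x z) : smoothDir x (c • z) := by
  have ht : Tendsto (fun t : ℝ => t * c) (𝓝 0) (𝓝 0) := by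
    have : Continuous (fun t : ℝ => t * c) := by fun_prop
    simpa using this.tendsto 0
  have h2 := h.comp_tendsto ht
  have h3 : ((fun t : ℝ => t) ∘ fun t : ℝ => t * c) =O[𝓝 (0 : ℝ)] (fun t : ℝ => t) := by
    refine IsBigO.of_bound |c| (Eventually.of_forall fun t => ?_)
    simp [abs_mul, mul_comm]
  have h4 := h2.trans_isBigO h3
  refine h4.congr_left fun t => ?_
  simp [mul_smul]

theorem smoothDir_add {X : Type} [NormedAddCommGroup X] [NormedSpace ℝ X] {x z w : X}
    (hz : smoothDir x z) (hw : smoothDir x w) : smoothDir x (z + w) := by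
  have a1 := smoothDir_smul 2 hz
  have a2 := smoothDir_smul 2 hw
  have a3 := smoothDir_smul (-2) hz
  have a4 := smoothDir_smul (-2) hw
  unfold smoothDir at *
  have key := ((a1.norm_left.add a2.norm_left).add (a3.norm_left.add a4.norm_left))
  refine IsBigO.trans_isLittleO (IsBigO.of_bound 1 (Eventually.of_forall fun t => ?_)) key
  have conv : ∀ a b : X, ‖(1/2 : ℝ) • (a + b)‖ ≤ (‖a‖ + ‖b‖) / 2 := by
    intro a b
    rw [norm_smul]
    have := norm_add_le a b
    norm_num
    linarith
  have e1 := conv (x + t • (2:ℝ) • z) (x + t • (2:ℝ) • w)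
  have e2 := conv (x + t • (-2:ℝ) • z) (x + t • (-2:ℝ) • w)
  have e3 := conv (x + t • (z + w)) (x - t • (z + w))
  rw [show (1/2 : ℝ) • ((x + t • (2:ℝ) • z) + (x + t • (2:ℝ) • w)) = x + t • (z + w) by module]
    at e1
  rw [show (1/2 : ℝ) • ((x + t • (-2:ℝ) • z) + (x + t • (-2:ℝ) • w)) = x - t • (z + w) by module]
    at e2
  rw [show (1/2 : ℝ) • ((x + t • (z + w)) + (x - t • (z + w))) = x by module] at e3
  simp only [Real.norm_eq_abs, one_mul]
  have b1 := le_abs_self (‖x + t • (2:ℝ) • z‖ - ‖x‖)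
  have b2 := le_abs_self (‖x + t • (2:ℝ) • w‖ - ‖x‖)
  have b3 := le_abs_self (‖x + t • (-2:ℝ) • z‖ - ‖x‖)
  have b4 := le_abs_self (‖x + t • (-2:ℝ) • w‖ - ‖x‖)
  have c1 := abs_nonneg (‖x + t • (2:ℝ) • z‖ - ‖x‖)
  have c2 := abs_nonneg (‖x + t • (2:ℝ) • w‖ - ‖x‖)
  have c3 := abs_nonneg (‖x + t • (-2:ℝ) • z‖ - ‖x‖)
  have c4 := abs_nonneg (‖x + t • (-2:ℝ) • w‖ - ‖x‖)
  refine le_trans ?_ (le_abs_self _)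
  rw [abs_le]
  constructor <;> linarith

theorem isFlex_iff {V X : Type} [NormedAddCommGroup X] [NormedSpace ℝ X]
    (G : SimpleGraph V) (p u : V → X) :
    IsFlex G p u ↔ ∀ v w, G.Adj v w → smoothDir (p v - p w) (u v - u w) := by
  have : ∀ v w (t : ℝ), (p v + t • u v) - (p w + t • u w) = (p v - p w) + t • (u v - u w) := by
    intro v w t; module
  simp only [IsFlex, smoothDir, this]

def flexSpace {V X : Type} [NormedAddCommGroup X] [NormedSpace ℝ X]
    (G : SimpleGraph V) (p : V → X) : Submodule ℝ (V → X) where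
  carrier := {u | IsFlex G p u}
  zero_mem' := by
    simp only [Set.mem_setOf_eq, isFlex_iff]
    intro v w _
    simp [smoothDir]
  add_mem' := by
    intro a b ha hb
    simp only [Set.mem_setOf_eq, isFlex_iff] at *
    intro v w h
    have := smoothDir_add (ha v w h) (hb v w h)
    rwa [show a v - a w + (b v - b w) = (a + b) v - (a + b) w by
      simp only [Pi.add_apply]; abel] at this
  smul_mem' := by
    intro c a ha
    simp only [Set.mem_setOf_eq, isFlex_iff] at *
    intro v w h
    have := smoothDir_smul c (ha v w h)
    rwa [smul_sub] at this

theorem statement_15 {V X : Type} [NormedAddCommGroup X] [NormedSpace ℝ X]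
    [FiniteDimensional ℝ X]
    (T : Tower (⊤ : SimpleGraph V)) (p : V → X)
    (hp : ∀ k, IsPlacement (T.seq k).spanningCoe p)
    (u₁ : V → X) (h₁ : IsFlex (T.seq 0).spanningCoe p u₁)
    (hend : ∀ k, ∃ u, IsFlex (T.seq k).spanningCoe p u ∧ ∀ v ∈ (T.seq 0).verts, u v = u₁ v) :
    ∃ U : ℕ → V → X,
      (∀ v ∈ (T.seq 0).verts, U 0 v = u₁ v) ∧
      (∀ k, IsFlex (T.seq k).spanningCoe p (U k)) ∧
      (∀ k, ∀ v ∈ (T.seq k).verts, U (k + 1) v = U k v) := by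
  have hmono : Monotone T.seq := monotone_nat_of_le_succ T.mono
  have hanti : ∀ m n, m ≤ n → ∀ u, IsFlex (T.seq n).spanningCoe p u →
      IsFlex (T.seq m).spanningCoe p u := by
    intro m n h u hu v w hvw
    exact hu ((hmono h).2 hvw)
  let P : ℕ → (V → X) → Prop := fun k u =>
    ∀ m, ∃ u', IsFlex (T.seq m).spanningCoe p u' ∧ ∀ v ∈ (T.seq k).verts, u' v = u v
  have step : ∀ k u, P k u → ∃ w, P (k + 1) w ∧ ∀ v ∈ (T.seq k).verts, w v = u v := by
    intro k u hu
    haveI : Finite (T.seq (k+1)).verts := T.finite (k+1)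
    let R : (V → X) →ₗ[ℝ] ((T.seq (k+1)).verts → X) :=
      LinearMap.funLeft ℝ X (Subtype.val : (T.seq (k+1)).verts → V)
    let f : ℕ →o (Submodule ℝ ((T.seq (k+1)).verts → X))ᵒᵈ :=
      { toFun := fun m => OrderDual.toDual ((flexSpace (T.seq m).spanningCoe p).map R)
        monotone' := by
          intro m n h
          exact Submodule.map_mono (fun u hu => hanti m n h u hu) }
    obtain ⟨n, hn⟩ := IsArtinian.monotone_stabilizes f
    obtain ⟨u', hu', hres⟩ := hu n
    refine ⟨u', fun m => ?_, hres⟩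
    rcases le_total m n with h | h
    · exact ⟨u', hanti m n h u' hu', fun _ _ => rfl⟩
    · have e : (flexSpace (T.seq n).spanningCoe p).map R
          = (flexSpace (T.seq m).spanningCoe p).map R := hn m h
      have hm : R u' ∈ (flexSpace (T.seq n).spanningCoe p).map R :=
        Submodule.mem_map_of_mem hu'
      rw [e] at hm
      obtain ⟨w, hw, hwe⟩ := hm
      exact ⟨w, hw, fun v hv => congrFun hwe ⟨v, hv⟩⟩
  choose! g hg1 hg2 using step
  let U : ℕ → V → X := fun k => Nat.rec u₁ (fun k u => g k u) k
  have hU : ∀ k, P k (U k) := by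
    intro k
    induction k with
    | zero => exact hend
    | succ k ih => exact hg1 k _ ih
  refine ⟨U, fun _ _ => rfl, fun k => ?_, fun k => hg2 k _ (hU k)⟩
  obtain ⟨u', hu', he⟩ := hU k k
  intro v w hvw
  have hv : (T.seq k).Adj v w := hvw
  rw [← he v hv.fst_mem, ← he w hv.snd_mem]
  exact hu' hvw

end RigidityPaper
end
end
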